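/- arXiv:2008.09595 — 6 statements merged into one kernel-verified Lean document; each statement's English description precedes it below -/
import Mathlib

section
/- Let n ≥ 2 be an integer, α ∈ ℝ, and let Ω ⊆ ℝⁿ be an open set with 0 ∈ Ω. Let u ∈ C¹(Ω \ {0}) be a weak solution of −Δₙu = |x|^{nα} e^{u} on Ω \ {0} such that |x|^{nα} e^{u} is integrable on Ω and |∇u|^{n−1} is integrable on Ω. Then there exists γ ∈ ℝ such that for every C¹ function φ : ℝⁿ → ℝ with compact support contained in Ω, ∫_Ω |∇u|^{n−2}⟨∇u, ∇φ⟩ dx = ∫_Ω |x|^{nα} e^{u} φ dx − γ φ(0). -/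
open MeasureTheory Metric Filter Topology Real Set
open scoped InnerProductSpace

/-- The Lebesgue volume of the unit ball in `ℝⁿ`. -/
noncomputable def omegaN (n : ℕ) : ℝ :=
  (volume (ball (0 : EuclideanSpace ℝ (Fin n)) 1)).toReal

/-- `c_γ = sign γ * (|γ| / (n ωₙ))^{1/(n-1)}`. -/
noncomputable def cgamma (n : ℕ) (γ : ℝ) : ℝ :=
  Real.sign γ * (|γ| / ((n : ℝ) * omegaN n)) ^ ((1 : ℝ) / ((n : ℝ) - 1))

/-- `u` is a weak solution of `-Δₙ u = f` on `U`. -/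
def IsWeakNSol (n : ℕ) (U : Set (EuclideanSpace ℝ (Fin n)))
    (u f : EuclideanSpace ℝ (Fin n) → ℝ) : Prop :=
  ∀ φ : EuclideanSpace ℝ (Fin n) → ℝ, ContDiff ℝ 1 φ → HasCompactSupport φ →
    tsupport φ ⊆ U →
    ∫ x in U, ‖gradient u x‖ ^ (n - 2) * ⟪gradient u x, gradient φ x⟫_ℝ
      = ∫ x in U, f x * φ x

theorem integrable_mul_of_hasCompactSupport {X : Type*} [TopologicalSpace X]
    [MeasurableSpace X] [OpensMeasurableSpace X] {μ : Measure X} {f φ : X → ℝ}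
    (hf : Integrable f μ) (hφ : Continuous φ) (hφc : HasCompactSupport φ) :
    Integrable (fun x => f x * φ x) μ := by
  obtain ⟨C, hC⟩ := hφc.exists_bound_of_continuous hφ
  exact hf.mul_bdd hφ.aestronglyMeasurable (ae_of_all _ hC)

section PointSingularity

variable {E : Type*} [NormedAddCommGroup E] [NormedSpace ℝ E]

/-- Rescaled bump functions, equal to one near the origin and shrinking to it, whose gradients
are bounded by a multiple of `1 / ‖x‖`. -/
theorem exists_shrinking_cutoff [FiniteDimensional ℝ E] [HasContDiffBump E] :
    ∃ (η : ℕ → E → ℝ) (C : ℝ), (∀ k, ContDiff ℝ 1 (η k)) ∧ (∀ k, η k =ᶠ[𝓝 0] 1) ∧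
      (∀ k x, ‖η k x‖ ≤ 1) ∧ (∀ k x, ‖x‖ * ‖fderiv ℝ (η k) x‖ ≤ C) ∧
      ∀ x, x ≠ 0 → ∀ᶠ k in atTop, η k =ᶠ[𝓝 x] 0 := by
  let b : ContDiffBump (0 : E) := ⟨1, 2, one_pos, one_lt_two⟩
  have hb : ContDiff ℝ 1 b := b.contDiff
  obtain ⟨C, hC⟩ := (b.hasCompactSupport.fderiv ℝ).exists_bound_of_continuous
    (hb.continuous_fderiv one_ne_zero)
  refine ⟨fun k x => b (((k : ℝ) + 1) • x), 2 * C, fun k => hb.comp (contDiff_const_smul _),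
    fun k => ?_, fun k x => ?_, fun k x => ?_, fun x hx => ?_⟩
  · have ht : Tendsto (fun x : E => ((k : ℝ) + 1) • x) (𝓝 0) (𝓝 0) := by
      simpa using (continuous_const_smul ((k : ℝ) + 1)).tendsto (0 : E)
    exact ht.eventually b.eventuallyEq_one
  · rw [Real.norm_of_nonneg b.nonneg]
    exact b.le_one
  · have hk : (0 : ℝ) < (k : ℝ) + 1 := by positivity
    rw [fderiv_comp_smul, norm_smul, Real.norm_of_nonneg hk.le]
    have hscale : ‖x‖ * (((k : ℝ) + 1) * ‖fderiv ℝ b (((k : ℝ) + 1) • x)‖)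
        = ‖((k : ℝ) + 1) • x‖ * ‖fderiv ℝ b (((k : ℝ) + 1) • x)‖ := by
      rw [norm_smul, Real.norm_of_nonneg hk.le]
      ring
    rw [hscale]
    generalize ((k : ℝ) + 1) • x = y
    by_cases hy : y ∈ tsupport b
    · rw [b.tsupport_eq, mem_closedBall_zero_iff] at hy
      exact mul_le_mul hy (hC y) (norm_nonneg _) zero_le_two
    · rw [fderiv_of_notMem_tsupport ℝ hy, norm_zero, mul_zero]
      exact mul_nonneg zero_le_two ((norm_nonneg _).trans (hC y))
  · obtain ⟨m, hm⟩ := exists_nat_gt (2 / ‖x‖)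
    filter_upwards [eventually_ge_atTop m] with k hk
    have hkm : (m : ℝ) ≤ k := by exact_mod_cast hk
    have hfar : 2 < ‖((k : ℝ) + 1) • x‖ := by
      rw [norm_smul, Real.norm_of_nonneg (by positivity), ← div_lt_iff₀ (norm_pos_iff.2 hx)]
      linarith
    have hopen : IsOpen {y : E | 2 < ‖((k : ℝ) + 1) • y‖} :=
      isOpen_lt continuous_const (by fun_prop)
    filter_upwards [hopen.mem_nhds hfar] with y hy
    refine b.zero_of_le_dist ?_
    rw [dist_zero_right]
    exact le_of_lt hy

variable [FiniteDimensional ℝ E] [MeasurableSpace E] [BorelSpace E] {μ : Measure E} {A : E → E}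
  {f : E → ℝ} {φ : E → ℝ}

theorem integrable_fderiv_apply (hA : Integrable A μ) (hφ : ContDiff ℝ 1 φ)
    (hφc : HasCompactSupport φ) : Integrable (fun x => fderiv ℝ φ x (A x)) μ := by
  have hcont := hφ.continuous_fderiv one_ne_zero
  obtain ⟨C, hC⟩ := (hφc.fderiv ℝ).exists_bound_of_continuous hcont
  refine (hA.norm.const_mul C).mono' ?_ (ae_of_all _ fun x => ?_)
  · exact (ContinuousLinearMap.id ℝ (E →L[ℝ] ℝ)).aestronglyMeasurable_comp₂
      hcont.aestronglyMeasurable hA.aestronglyMeasurable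
  · exact ((fderiv ℝ φ x).le_opNorm _).trans
      (mul_le_mul_of_nonneg_right (hC x) (norm_nonneg _))

/-- If `-div A = f` weakly away from the origin, with `A` and `f` integrable, then the equation
also holds against test functions that vanish at the origin. -/
theorem integral_fderiv_apply_sub_eq_zero [HasContDiffBump E] (hA : Integrable A μ)
    (hf : Integrable f μ) (hμ : ∀ᵐ x ∂μ, x ≠ 0) (hφ : ContDiff ℝ 1 φ)
    (hφc : HasCompactSupport φ) (hφ0 : φ 0 = 0)
    (hsol : ∀ ψ : E → ℝ, ContDiff ℝ 1 ψ → HasCompactSupport ψ → tsupport ψ ⊆ tsupport φ \ {0} →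
      ∫ x, (fderiv ℝ ψ x (A x) - f x * ψ x) ∂μ = 0) :
    ∫ x, (fderiv ℝ φ x (A x) - f x * φ x) ∂μ = 0 := by
  obtain ⟨η, C, hη, hη1, hηle, hηC, hη0⟩ := exists_shrinking_cutoff (E := E)
  obtain ⟨L, hL⟩ := hφ.lipschitzWith_of_hasCompactSupport hφc one_ne_zero
  obtain ⟨M, hM⟩ := hφc.exists_bound_of_continuous hφ.continuous
  have hφL : ∀ x, ‖φ x‖ ≤ L * ‖x‖ := fun x => by
    simpa [hφ0] using hL.norm_sub_le x 0
  have hcut : ∀ k, ContDiff ℝ 1 fun x => η k x * φ x := fun k => (hη k).mul hφ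
  have hcutc : ∀ k, HasCompactSupport fun x => η k x * φ x := fun k => hφc.mul_left
  have hint : ∀ ψ : E → ℝ, ContDiff ℝ 1 ψ → HasCompactSupport ψ →
      Integrable (fun x => fderiv ℝ ψ x (A x) - f x * ψ x) μ := fun ψ hψ hψc =>
    (integrable_fderiv_apply hA hψ hψc).sub
      (integrable_mul_of_hasCompactSupport hf hψ.continuous hψc)
  have hconst : ∀ k, ∫ x, (fderiv ℝ (fun y => η k y * φ y) x (A x) - f x * (η k x * φ x)) ∂μ
      = ∫ x, (fderiv ℝ φ x (A x) - f x * φ x) ∂μ := fun k => by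
    have hrest : ContDiff ℝ 1 fun x => φ x - η k x * φ x := hφ.sub (hcut k)
    have hsupp : tsupport (fun x => φ x - η k x * φ x) ⊆ tsupport φ \ {0} := by
      refine fun x hx => ⟨?_, ?_⟩
      · refine closure_mono (fun y hy => ?_) hx
        contrapose! hy
        simp [Function.notMem_support.1 hy]
      · rintro rfl
        refine notMem_tsupport_iff_eventuallyEq.2 ?_ hx
        filter_upwards [hη1 k] with y hy
        simp [hy]
    have hzero := hsol _ hrest (hφc.sub (hcutc k)) hsupp
    rw [eq_comm, ← sub_eq_zero, ← integral_sub (hint φ hφ hφc) (hint _ (hcut k) (hcutc k)),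
      ← hzero]
    refine integral_congr_ae (ae_of_all _ fun x => ?_)
    have hd := fderiv_fun_sub (hφ.differentiable one_ne_zero x)
      ((hcut k).differentiable one_ne_zero x)
    simp only [hd, sub_apply]
    ring
  have hlim : Tendsto (fun k => ∫ x, (fderiv ℝ (fun y => η k y * φ y) x (A x)
      - f x * (η k x * φ x)) ∂μ) atTop (𝓝 (∫ _, (0 : ℝ) ∂μ)) := by
    refine tendsto_integral_of_dominated_convergence
      (fun x => (L + L * C) * ‖A x‖ + M * ‖f x‖)
      (fun k => (hint _ (hcut k) (hcutc k)).aestronglyMeasurable)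
      ((hA.norm.const_mul _).add (hf.norm.const_mul _)) (fun k => ae_of_all _ fun x => ?_) ?_
    · have hd := fderiv_fun_mul ((hη k).differentiable one_ne_zero x)
        (hφ.differentiable one_ne_zero x)
      have hfd : ‖fderiv ℝ (fun y => η k y * φ y) x‖ ≤ L + L * C := by
        rw [hd]
        refine (norm_add_le _ _).trans (add_le_add ?_ ?_)
        · rw [norm_smul]
          simpa using mul_le_mul (hηle k x) (norm_fderiv_le_of_lipschitz ℝ hL)
            (norm_nonneg _) zero_le_one
        · rw [norm_smul]
          calc ‖φ x‖ * ‖fderiv ℝ (η k) x‖ ≤ L * ‖x‖ * ‖fderiv ℝ (η k) x‖ :=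
                mul_le_mul_of_nonneg_right (hφL x) (norm_nonneg _)
            _ ≤ L * C := by
                rw [mul_assoc]
                exact mul_le_mul_of_nonneg_left (hηC k x) L.coe_nonneg
      have hmul : ‖f x * (η k x * φ x)‖ ≤ M * ‖f x‖ := by
        rw [norm_mul, norm_mul, mul_comm]
        refine mul_le_mul_of_nonneg_right ?_ (norm_nonneg _)
        simpa using mul_le_mul (hηle k x) (hM x) (norm_nonneg _) zero_le_one
      exact (norm_sub_le _ _).trans (add_le_add (((fderiv ℝ _ x).le_opNorm _).trans
        (mul_le_mul_of_nonneg_right hfd (norm_nonneg _))) hmul)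
    · filter_upwards [hμ] with x hx
      refine tendsto_const_nhds.congr' ?_
      filter_upwards [hη0 x hx] with k hk
      have hprod : (fun y => η k y * φ y) =ᶠ[𝓝 x] fun _ => 0 := by
        filter_upwards [hk] with y hy
        simp [hy]
      have hval : η k x = 0 := hk.eq_of_nhds
      simp [hprod.fderiv_eq, hval]
  simp only [hconst, integral_zero] at hlim
  exact tendsto_nhds_unique tendsto_const_nhds hlim

end PointSingularity

theorem measurable_gradient {F : Type*} [NormedAddCommGroup F] [InnerProductSpace ℝ F]
    [CompleteSpace F] [MeasurableSpace F] [BorelSpace F] (u : F → ℝ) :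
    Measurable (gradient u) :=
  (InnerProductSpace.toDual ℝ F).symm.continuous.measurable.comp (measurable_fderiv ℝ u)

theorem extension_across_singularity
    (n : ℕ) (hn : 2 ≤ n) (α : ℝ)
    (Ω : Set (EuclideanSpace ℝ (Fin n))) (hΩ : IsOpen Ω)
    (h0 : (0 : EuclideanSpace ℝ (Fin n)) ∈ Ω)
    (u : EuclideanSpace ℝ (Fin n) → ℝ)
    (hu : ContDiffOn ℝ 1 u (Ω \ {0}))
    (hsol : IsWeakNSol n (Ω \ {0}) u (fun x => ‖x‖ ^ ((n : ℝ) * α) * Real.exp (u x)))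
    (hint : IntegrableOn (fun x => ‖x‖ ^ ((n : ℝ) * α) * Real.exp (u x)) Ω)
    (hgrad : IntegrableOn (fun x => ‖gradient u x‖ ^ (n - 1)) Ω) :
    ∃ γ : ℝ, ∀ φ : EuclideanSpace ℝ (Fin n) → ℝ, ContDiff ℝ 1 φ → HasCompactSupport φ →
        tsupport φ ⊆ Ω →
      ∫ x in Ω, ‖gradient u x‖ ^ (n - 2) * ⟪gradient u x, gradient φ x⟫_ℝ
        = (∫ x in Ω, ‖x‖ ^ ((n : ℝ) * α) * Real.exp (u x) * φ x) - γ * φ 0 := by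
  obtain ⟨m, rfl⟩ : ∃ m, n = m + 2 := ⟨n - 2, by omega⟩
  simp only [Nat.add_sub_cancel] at *
  set f : EuclideanSpace ℝ (Fin (m + 2)) → ℝ :=
    fun x => ‖x‖ ^ (((m + 2 : ℕ) : ℝ) * α) * Real.exp (u x) with hf_def
  set A : EuclideanSpace ℝ (Fin (m + 2)) → EuclideanSpace ℝ (Fin (m + 2)) :=
    fun x => ‖gradient u x‖ ^ m • gradient u x with hA_def
  have hflux : ∀ (φ : EuclideanSpace ℝ (Fin (m + 2)) → ℝ) x,
      ‖gradient u x‖ ^ m * ⟪gradient u x, gradient φ x⟫_ℝ = fderiv ℝ φ x (A x) := fun φ x => by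
    rw [inner_gradient_right]
    simp [hA_def]
  have hA : Integrable A (volume.restrict Ω) := by
    have hmeas := measurable_gradient u
    refine hgrad.mono' ((hmeas.norm.pow_const m).smul hmeas).aestronglyMeasurable
      (ae_of_all _ fun x => le_of_eq ?_)
    simp [hA_def, norm_smul, ← pow_succ]
  have hpunct : ∀ g : EuclideanSpace ℝ (Fin (m + 2)) → ℝ,
      ∫ x in Ω \ {0}, g x = ∫ x in Ω, g x := fun g =>
    setIntegral_congr_set (sdiff_null_ae_eq_self (measure_singleton _))
  have hne : ∀ᵐ x ∂(volume.restrict Ω), x ≠ (0 : EuclideanSpace ℝ (Fin (m + 2))) :=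
    ae_restrict_of_ae (Measure.ae_ne volume 0)
  simp only [IsWeakNSol, hflux, hpunct, Nat.add_sub_cancel] at hsol
  simp only [hflux]
  have hsub : ∀ ψ : EuclideanSpace ℝ (Fin (m + 2)) → ℝ, ContDiff ℝ 1 ψ → HasCompactSupport ψ →
      ∫ x in Ω, (fderiv ℝ ψ x (A x) - f x * ψ x)
        = (∫ x in Ω, fderiv ℝ ψ x (A x)) - ∫ x in Ω, f x * ψ x := fun ψ hψ hψc =>
    integral_sub (integrable_fderiv_apply hA hψ hψc)
      (integrable_mul_of_hasCompactSupport hint hψ.continuous hψc)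
  obtain ⟨χ, hχΩ, hχc, hχ, -, hχ0⟩ := exists_contDiff_tsupport_subset (n := 1) (hΩ.mem_nhds h0)
  replace hχ : ContDiff ℝ 1 χ := by exact_mod_cast hχ
  refine ⟨-∫ x in Ω, (fderiv ℝ χ x (A x) - f x * χ x), fun φ hφ hφc hφΩ => ?_⟩
  have hdiff : ContDiff ℝ 1 fun x => φ x - φ 0 * χ x := hφ.sub (contDiff_const.mul hχ)
  have hdiffc : HasCompactSupport fun x => φ x - φ 0 * χ x := hφc.sub hχc.mul_left
  have hdiffΩ : tsupport (fun x => φ x - φ 0 * χ x) ⊆ Ω :=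
    (tsupport_sub φ fun x => φ 0 * χ x).trans
      (union_subset hφΩ ((closure_mono (Function.support_mul_subset_right _ _)).trans hχΩ))
  have hzero := integral_fderiv_apply_sub_eq_zero hA hint hne hdiff hdiffc (by simp [hχ0])
    fun ψ hψ hψc hψΩ => by
      rw [hsub ψ hψ hψc, hsol ψ hψ hψc (hψΩ.trans (sdiff_subset_sdiff_left hdiffΩ)), sub_self]
  have hlin : ∫ x in Ω, (fderiv ℝ (fun y => φ y - φ 0 * χ y) x (A x) - f x * (φ x - φ 0 * χ x))
      = (∫ x in Ω, (fderiv ℝ φ x (A x) - f x * φ x))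
        - φ 0 * ∫ x in Ω, (fderiv ℝ χ x (A x) - f x * χ x) := by
    have hintegrable : ∀ ψ : EuclideanSpace ℝ (Fin (m + 2)) → ℝ, ContDiff ℝ 1 ψ →
        HasCompactSupport ψ →
        Integrable (fun x => fderiv ℝ ψ x (A x) - f x * ψ x) (volume.restrict Ω) :=
      fun ψ hψ hψc => (integrable_fderiv_apply hA hψ hψc).sub
        (integrable_mul_of_hasCompactSupport hint hψ.continuous hψc)
    rw [← integral_const_mul, ← integral_sub (hintegrable φ hφ hφc)
      ((hintegrable χ hχ hχc).const_mul _)]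
    refine integral_congr_ae (ae_of_all _ fun x => ?_)
    have hχx := hχ.differentiable one_ne_zero x
    have hd : fderiv ℝ (fun y => φ y - φ 0 * χ y) x = fderiv ℝ φ x - φ 0 • fderiv ℝ χ x := by
      rw [fderiv_fun_sub (hφ.differentiable one_ne_zero x) (hχx.const_mul _),
        fderiv_const_mul hχx]
    simp only [hd, sub_apply, smul_apply, smul_eq_mul]
    ring
  rw [hlin, hsub φ hφ hφc] at hzero
  linarith
end

section
/- Let n ≥ 2 be an integer, α ∈ ℝ, let Ω ⊆ ℝⁿ be an open set, and let u ∈ C¹(Ω \ {0}) be a weak solution of −Δₙu = |x|^{nα} e^{u} on Ω \ {0}. Define Ω̂ = { x ∈ ℝⁿ \ {0} : x/|x|² ∈ Ω \ {0} } and û(x) = u(x/|x|²) for x ∈ Ω̂. Then û ∈ C¹(Ω̂) and û is a weak solution of −Δₙ û = |x|^{−n(α+2)} e^{û} on Ω̂. -/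
open MeasureTheory Metric Filter Topology Real Set
open scoped InnerProductSpace

section Inversion

open EuclideanGeometry Module

variable {E : Type*} [NormedAddCommGroup E] [InnerProductSpace ℝ E]

lemma inversion_zero_one_apply (x : E) : inversion (0 : E) 1 x = (‖x‖ ^ 2)⁻¹ • x := by
  simp [inversion]

lemma norm_inversion_zero_one (x : E) : ‖inversion (0 : E) 1 x‖ = ‖x‖⁻¹ := by
  simpa using dist_inversion_center (0 : E) x 1

lemma contDiffAt_inversion_zero_one {x : E} (hx : x ≠ 0) :
    ContDiffAt ℝ 1 (inversion (0 : E) 1) x :=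
  ContDiffAt.inversion (n := 1) contDiffAt_const contDiffAt_const contDiffAt_id hx

lemma hasFDerivAt_inversion_zero_one {x : E} (hx : x ≠ 0) :
    HasFDerivAt (inversion (0 : E) 1)
      ((‖x‖ ^ 2)⁻¹ • ((ℝ ∙ x)ᗮ.reflection : E →L[ℝ] E)) x := by
  simpa using hasFDerivAt_inversion (R := 1) hx

lemma abs_det_smul_reflection [FiniteDimensional ℝ E] (c : ℝ) (S : Submodule ℝ E) :
    |(c • (S.reflection : E →L[ℝ] E)).det| = |c| ^ finrank ℝ E := by
  have h : ((c • (S.reflection : E →L[ℝ] E) : E →L[ℝ] E) : E →ₗ[ℝ] E)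
      = c • S.reflection.toLinearMap := rfl
  rw [ContinuousLinearMap.det, h, LinearMap.det_smul, Submodule.det_reflection]
  simp [abs_mul]

/-- Chain rule for the gradient under the inversion in the unit sphere. -/
lemma gradient_comp_inversion [CompleteSpace E] {f : E → ℝ} {x : E} (hx : x ≠ 0)
    (hf : DifferentiableAt ℝ f (inversion 0 1 x)) :
    gradient (fun y => f (inversion 0 1 y)) x
      = (‖x‖ ^ 2)⁻¹ • (ℝ ∙ x)ᗮ.reflection (gradient f (inversion 0 1 x)) := by
  refine ext_inner_right ℝ fun v => ?_
  have h : HasFDerivAt (fun y => f (inversion 0 1 y)) _ x :=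
    hf.hasFDerivAt.comp x (hasFDerivAt_inversion_zero_one hx)
  have hsymm : ⟪(ℝ ∙ x)ᗮ.reflection (gradient f (inversion 0 1 x)), v⟫_ℝ
      = ⟪gradient f (inversion 0 1 x), (ℝ ∙ x)ᗮ.reflection v⟫_ℝ := by
    rw [← (ℝ ∙ x)ᗮ.reflection.inner_map_map, Submodule.reflection_reflection]
  rw [inner_gradient_left, h.fderiv, real_inner_smul_left, hsymm, inner_gradient_left]
  simp

/-- The density of the `(p + 2)`-energy is conformally covariant under the inversion. -/
lemma energy_comp_inversion [CompleteSpace E] (p : ℕ) {f g : E → ℝ} {x : E} (hx : x ≠ 0)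
    (hf : DifferentiableAt ℝ f (inversion 0 1 x)) (hg : DifferentiableAt ℝ g (inversion 0 1 x)) :
    ‖gradient (fun y => f (inversion 0 1 y)) x‖ ^ p
        * ⟪gradient (fun y => f (inversion 0 1 y)) x, gradient (fun y => g (inversion 0 1 y)) x⟫_ℝ
      = (‖x‖ ^ 2)⁻¹ ^ (p + 2) * (‖gradient f (inversion 0 1 x)‖ ^ p
        * ⟪gradient f (inversion 0 1 x), gradient g (inversion 0 1 x)⟫_ℝ) := by
  rw [gradient_comp_inversion hx hf, gradient_comp_inversion hx hg, norm_smul,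
    real_inner_smul_left, real_inner_smul_right, LinearIsometryEquiv.norm_map,
    LinearIsometryEquiv.inner_map_map, Real.norm_of_nonneg (by positivity)]
  ring

/-- Change of variables for the inversion in the unit sphere. -/
lemma setIntegral_image_inversion [FiniteDimensional ℝ E] [MeasurableSpace E] [BorelSpace E]
    {s : Set E} (hs : MeasurableSet s) (h0 : (0 : E) ∉ s) (g : E → ℝ) :
    ∫ x in inversion (0 : E) 1 '' s, g x
      = ∫ x in s, (‖x‖ ^ 2)⁻¹ ^ finrank ℝ E * g (inversion 0 1 x) := by
  have hne {x : E} (hx : x ∈ s) : x ≠ 0 := ne_of_mem_of_not_mem hx h0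
  rw [integral_image_eq_integral_abs_det_fderiv_smul volume hs
    (fun x hx => (hasFDerivAt_inversion_zero_one (hne hx)).hasFDerivWithinAt)
    (inversion_injective _ one_ne_zero).injOn]
  refine setIntegral_congr_fun hs fun x _ => ?_
  simp only [abs_det_smul_reflection, smul_eq_mul]
  rw [abs_of_nonneg (by positivity)]

lemma tsupport_comp_inversion_subset {φ : E → ℝ} (hc : HasCompactSupport φ)
    (h0 : (0 : E) ∉ tsupport φ) :
    IsCompact (inversion (0 : E) 1 '' tsupport φ) ∧
      tsupport (fun x => φ (inversion 0 1 x)) ⊆ inversion (0 : E) 1 '' tsupport φ := by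
  have hK : IsCompact (inversion (0 : E) 1 '' tsupport φ) :=
    hc.image_of_continuousOn fun x hx =>
      (contDiffAt_inversion_zero_one (ne_of_mem_of_not_mem hx h0)).continuousAt.continuousWithinAt
  exact ⟨hK, closure_minimal (fun x hx => ⟨_, subset_tsupport _ hx,
    inversion_inversion _ one_ne_zero x⟩) hK.isClosed⟩

lemma contDiff_comp_inversion {φ : E → ℝ} (hφ : ContDiff ℝ 1 φ) (hc : HasCompactSupport φ)
    (h0 : (0 : E) ∉ tsupport φ) : ContDiff ℝ 1 (fun x => φ (inversion 0 1 x)) := by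
  refine contDiff_iff_contDiffAt.2 fun x => ?_
  rcases eq_or_ne x 0 with rfl | hx
  · have h : (0 : E) ∉ tsupport (fun x => φ (inversion 0 1 x)) := fun h => by
      obtain ⟨y, hy, hy0⟩ := (tsupport_comp_inversion_subset hc h0).2 h
      exact h0 ((inversion_eq_center one_ne_zero).1 hy0 ▸ hy)
    exact contDiffAt_const.congr_of_eventuallyEq (notMem_tsupport_iff_eventuallyEq.1 h)
  · exact hφ.contDiffAt.comp x (contDiffAt_inversion_zero_one hx)

end Inversion

theorem kelvin_transform_invariance
    (n : ℕ) (hn : 2 ≤ n) (α : ℝ)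
    (Ω : Set (EuclideanSpace ℝ (Fin n))) (hΩ : IsOpen Ω)
    (u : EuclideanSpace ℝ (Fin n) → ℝ)
    (hu : ContDiffOn ℝ 1 u (Ω \ {0}))
    (hsol : IsWeakNSol n (Ω \ {0}) u (fun x => ‖x‖ ^ ((n : ℝ) * α) * Real.exp (u x))) :
    let K : EuclideanSpace ℝ (Fin n) → EuclideanSpace ℝ (Fin n) := fun x => (‖x‖ ^ 2)⁻¹ • x
    let Ωhat : Set (EuclideanSpace ℝ (Fin n)) := {x | x ≠ 0 ∧ K x ∈ Ω \ {0}}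
    let uhat : EuclideanSpace ℝ (Fin n) → ℝ := fun x => u (K x)
    ContDiffOn ℝ 1 uhat Ωhat ∧
    IsWeakNSol n Ωhat uhat
      (fun x => ‖x‖ ^ (-((n : ℝ) * (α + 2))) * Real.exp (uhat x)) := by
  intro K Ωhat uhat
  have hK : K = EuclideanGeometry.inversion 0 1 :=
    funext fun x => (inversion_zero_one_apply x).symm
  have hKK (x) : K (K x) = x := by
    rw [hK]; exact EuclideanGeometry.inversion_inversion _ one_ne_zero x
  have hV : IsOpen (Ω \ {0}) := hΩ.sdiff isClosed_singleton
  have hdiff {x} (hx : x ∈ Ωhat) : ContDiffAt ℝ 1 u (K x) := hu.contDiffAt (hV.mem_nhds hx.2)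
  have hKdiff {x} (hx : x ≠ 0) : ContDiffAt ℝ 1 K x := hK ▸ contDiffAt_inversion_zero_one hx
  have himage : K '' Ωhat = Ω \ {0} := by
    refine Subset.antisymm (image_subset_iff.2 fun x hx => hx.2) fun y hy => ⟨K y, ⟨?_, ?_⟩, hKK y⟩
    · rw [hK]
      exact fun h => hy.2 ((EuclideanGeometry.inversion_eq_center one_ne_zero).1 h)
    · rwa [hKK]
  have hWm : MeasurableSet Ωhat := by
    have hKc : ContinuousOn K {0}ᶜ := fun x hx => (hKdiff hx).continuousAt.continuousWithinAt
    exact (hKc.isOpen_inter_preimage isOpen_compl_singleton hV).measurableSet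
  have h0W : (0 : EuclideanSpace ℝ (Fin n)) ∉ Ωhat := fun h => h.1 rfl
  refine ⟨fun x hx => ((hdiff hx).comp x (hKdiff hx.1)).contDiffWithinAt, fun φ hφ hc hsupp => ?_⟩
  have h0 : (0 : EuclideanSpace ℝ (Fin n)) ∉ tsupport φ := fun h => h0W (hsupp h)
  obtain ⟨hcomp, hsub⟩ := tsupport_comp_inversion_subset hc h0
  have hψ := contDiff_comp_inversion hφ hc h0
  rw [← hK] at hcomp hsub
  have key := hsol _ hψ (hcomp.of_isClosed_subset (isClosed_tsupport _) (by rwa [← hK]))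
    (by rw [← hK, ← himage]; exact hsub.trans (image_mono hsupp))
  rw [← himage, hK, setIntegral_image_inversion hWm h0W, setIntegral_image_inversion hWm h0W,
    finrank_euclideanSpace_fin, ← hK] at key
  refine Eq.trans (setIntegral_congr_fun hWm fun x hx => ?_)
    (key.trans (setIntegral_congr_fun hWm fun x hx => ?_))
  · have h := energy_comp_inversion (n - 2) hx.1 (hK ▸ (hdiff hx).differentiableAt one_ne_zero)
      (hψ.differentiable one_ne_zero _)
    rw [← hK, Nat.sub_add_cancel hn] at h
    simpa only [hKK] using h
  · have hpos : 0 < ‖x‖ := norm_pos_iff.2 hx.1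
    have hnorm : ‖K x‖ = ‖x‖⁻¹ := by rw [hK, norm_inversion_zero_one]
    have hpow : ‖x‖ ^ (-((n : ℝ) * (α + 2))) = (‖x‖ ^ 2)⁻¹ ^ n * ‖K x‖ ^ ((n : ℝ) * α) := by
      rw [hnorm, Real.inv_rpow hpos.le, ← Real.rpow_neg hpos.le, inv_pow, ← pow_mul,
        ← Real.rpow_natCast, ← Real.rpow_neg hpos.le, ← Real.rpow_add hpos]
      congr 1
      push_cast
      ring
    simp only [hKK, hpow, uhat]
    ring
end

section
/- Let n ≥ 2 be an integer. Then the quantity d := inf { ⟨|X|^{n−2}X − |Y|^{n−2}Y, X − Y⟩ / |X − Y|ⁿ : X, Y ∈ ℝⁿ, X ≠ Y } is strictly positive; equivalently, there exists d > 0 such that ⟨|X|^{n−2}X − |Y|^{n−2}Y, X − Y⟩ ≥ d |X − Y|ⁿ for all X, Y ∈ ℝⁿ. -/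
open MeasureTheory Metric Filter Topology Real Set
open scoped InnerProductSpace

/-- The elementary monotonicity inequality for the field `X ↦ ‖X‖ ^ m • X`. -/
theorem half_add_mul_norm_sub_sq_le_inner {E : Type*} [NormedAddCommGroup E]
    [InnerProductSpace ℝ E] (m : ℕ) (X Y : E) :
    (‖X‖ ^ m + ‖Y‖ ^ m) / 2 * ‖X - Y‖ ^ 2 ≤ ⟪‖X‖ ^ m • X - ‖Y‖ ^ m • Y, X - Y⟫_ℝ := by
  have hmono : 0 ≤ (‖X‖ ^ m - ‖Y‖ ^ m) * (‖X‖ ^ 2 - ‖Y‖ ^ 2) := by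
    rcases le_total ‖X‖ ‖Y‖ with h | h
    · exact mul_nonneg_of_nonpos_of_nonpos (sub_nonpos.2 (by gcongr)) (sub_nonpos.2 (by gcongr))
    · exact mul_nonneg (sub_nonneg.2 (by gcongr)) (sub_nonneg.2 (by gcongr))
  have hinner : ⟪‖X‖ ^ m • X - ‖Y‖ ^ m • Y, X - Y⟫_ℝ =
      ‖X‖ ^ m * (‖X‖ ^ 2 - ⟪X, Y⟫_ℝ) - ‖Y‖ ^ m * (⟪X, Y⟫_ℝ - ‖Y‖ ^ 2) := by
    simp only [inner_sub_left, inner_sub_right, real_inner_smul_left,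
      real_inner_self_eq_norm_sq, real_inner_comm X Y]
    ring
  rw [hinner, norm_sub_sq_real]
  linarith

/-- A power of the distance is controlled by the sum of the powers of the norms. -/
theorem norm_sub_pow_le_two_pow_mul {E : Type*} [SeminormedAddCommGroup E] (m : ℕ) (X Y : E) :
    ‖X - Y‖ ^ m ≤ 2 ^ m * (‖X‖ ^ m + ‖Y‖ ^ m) := by
  calc ‖X - Y‖ ^ m ≤ (‖X‖ + ‖Y‖) ^ m := by gcongr; exact norm_sub_le X Y
    _ ≤ 2 ^ (m - 1) * (‖X‖ ^ m + ‖Y‖ ^ m) := add_pow_le (norm_nonneg X) (norm_nonneg Y) m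
    _ ≤ 2 ^ m * (‖X‖ ^ m + ‖Y‖ ^ m) := by
      gcongr
      · norm_num
      · exact Nat.sub_le m 1

theorem monotonicity_constant_positive
    (n : ℕ) (hn : 2 ≤ n) :
    ∃ d : ℝ, 0 < d ∧ ∀ X Y : EuclideanSpace ℝ (Fin n),
      ⟪‖X‖ ^ (n - 2) • X - ‖Y‖ ^ (n - 2) • Y, X - Y⟫_ℝ ≥ d * ‖X - Y‖ ^ n := by
  obtain ⟨m, rfl⟩ := Nat.exists_eq_add_of_le' hn
  refine ⟨1 / (2 * 2 ^ m), by positivity, fun X Y => ?_⟩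
  rw [Nat.add_sub_cancel]
  calc 1 / (2 * 2 ^ m) * ‖X - Y‖ ^ (m + 2)
      = 1 / (2 * 2 ^ m) * ‖X - Y‖ ^ m * ‖X - Y‖ ^ 2 := by ring
    _ ≤ 1 / (2 * 2 ^ m) * (2 ^ m * (‖X‖ ^ m + ‖Y‖ ^ m)) * ‖X - Y‖ ^ 2 := by
      gcongr
      exact norm_sub_pow_le_two_pow_mul m X Y
    _ = (‖X‖ ^ m + ‖Y‖ ^ m) / 2 * ‖X - Y‖ ^ 2 := by field_simp
    _ ≤ _ := half_add_mul_norm_sub_sq_le_inner m X Y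
end

section
/- Let n ≥ 2 be an integer and γ > 0. Then there exists a radial function U ∈ C¹(ℝⁿ \ {0}), U(x) = f(|x|) with f ∈ C¹((0,∞)), such that ∫_{ℝⁿ} e^{U} dx < ∞; for every C¹ function φ : ℝⁿ → ℝ with compact support, ∫_{ℝⁿ} |∇U|^{n−2}⟨∇U, ∇φ⟩ dx = ∫_{ℝⁿ} e^{U} φ dx − γ φ(0); f is strictly increasing on (0,1) and strictly decreasing on (1,∞) with f ≤ f(1); and moreover for every λ > 0 the rescaled function U_λ(x) := U(λx) + n log λ satisfies the same weak equation ∫_{ℝⁿ} |∇U_λ|^{n−2}⟨∇U_λ, ∇φ⟩ dx = ∫_{ℝⁿ} e^{U_λ} φ dx − γ φ(0) for all such φ, and its radial profile attains its unique absolute maximum at radius 1/λ. -/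
open MeasureTheory Metric Filter Topology Real Set
open scoped InnerProductSpace

section Polar

variable {E : Type*} [NormedAddCommGroup E]

/-- Integration in polar coordinates. -/
theorem integral_eq_integral_sphere_integral_Ioi [NormedSpace ℝ E] [FiniteDimensional ℝ E]
    [Nontrivial E] [MeasurableSpace E] [BorelSpace E] (μ : Measure E)
    [μ.IsAddHaarMeasure] {D : E → ℝ} (hD : Integrable D μ) :
    ∫ x, D x ∂μ = ∫ θ : sphere (0 : E) 1, (∫ r in Ioi (0 : ℝ),
      r ^ (Module.finrank ℝ E - 1) * D (r • (θ : E))) ∂μ.toSphere := by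
  have hmp := μ.measurePreserving_homeomorphUnitSphereProd
  have hemb := (homeomorphUnitSphereProd E).measurableEmbedding
  set g : sphere (0 : E) 1 × Ioi (0 : ℝ) → ℝ := fun p => D ((p.2 : ℝ) • (p.1 : E)) with hg
  have hgx : ∀ x : ({(0 : E)}ᶜ : Set E), g (homeomorphUnitSphereProd E x) = D x := by
    intro x
    have hx : ‖(x : E)‖ ≠ 0 := norm_ne_zero_iff.2 x.2
    simp [hg, smul_smul, hx]
  have hgi : Integrable g (μ.toSphere.prod (.volumeIoiPow (Module.finrank ℝ E - 1))) := by
    rw [← hmp.integrable_comp_emb hemb]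
    have : g ∘ homeomorphUnitSphereProd E = D ∘ ((↑) : ({(0 : E)}ᶜ : Set E) → E) :=
      funext hgx
    rw [this, ← integrableOn_iff_comap_subtypeVal (measurableSet_singleton _).compl]
    exact hD.integrableOn
  calc
    ∫ x, D x ∂μ = ∫ x : ({(0 : E)}ᶜ : Set E), D x ∂(μ.comap (↑)) := by
      rw [integral_subtype_comap (measurableSet_singleton _).compl D, restrict_compl_singleton]
    _ = ∫ p, g p ∂μ.toSphere.prod (.volumeIoiPow (Module.finrank ℝ E - 1)) := by
      rw [← hmp.integral_comp hemb g]
      simp_rw [hgx]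
    _ = ∫ θ, ∫ r, g (θ, r) ∂.volumeIoiPow (Module.finrank ℝ E - 1) ∂μ.toSphere :=
      integral_prod _ hgi
    _ = _ := by
      congr 1 with θ
      simp only [Measure.volumeIoiPow, ENNReal.ofReal]
      rw [integral_withDensity_eq_integral_smul
          ((measurable_subtype_coe.pow_const _).real_toNNReal),
        integral_subtype_comap measurableSet_Ioi fun a : ℝ ↦
          Real.toNNReal (a ^ (Module.finrank ℝ E - 1)) • D (a • (θ : E))]
      refine setIntegral_congr_fun measurableSet_Ioi fun x hx ↦ ?_
      simp only [NNReal.smul_def, Real.coe_toNNReal _ (pow_nonneg (mem_Ioi.1 hx).le _), smul_eq_mul]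

variable [InnerProductSpace ℝ E]

theorem hasGradientAt_comp_norm [CompleteSpace E] {F : ℝ → ℝ} {F' : ℝ} {x : E} (hx : x ≠ 0)
    (hF : HasDerivAt F F' ‖x‖) :
    HasGradientAt (fun y : E => F ‖y‖) ((F' * ‖x‖⁻¹) • x) x := by
  have hx' : ‖x‖ ≠ 0 := norm_ne_zero_iff.2 hx
  have h1 := (hasStrictFDerivAt_norm_sq x).hasFDerivAt.sqrt (pow_ne_zero 2 hx')
  simp only [Real.sqrt_sq (norm_nonneg _)] at h1
  rw [hasGradientAt_iff_hasFDerivAt]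
  refine (hF.comp_hasFDerivAt x h1).congr_fderiv ?_
  ext y
  simp only [smul_apply, innerSL_apply_apply, smul_eq_mul,
    InnerProductSpace.toDual_apply_apply, inner_smul_left, nsmul_eq_mul]
  simp
  field_simp

/-- The flux of a radial gradient, tested against a linear form. -/
theorem norm_gradient_pow_mul_inner [CompleteSpace E] {d : ℕ} (hd : 2 ≤ d) {F F' q : ℝ → ℝ}
    (hF : ∀ r, 0 < r → HasDerivAt F (F' r) r)
    (hflux : ∀ r, 0 < r → |F' r| ^ (d - 2) * F' r * r ^ (d - 1) = q r)
    {x : E} (hx : x ≠ 0) (φ : E → ℝ) :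
    ‖gradient (fun y : E => F ‖y‖) x‖ ^ (d - 2) *
      ⟪gradient (fun y : E => F ‖y‖) x, gradient φ x⟫_ℝ =
      q ‖x‖ * (‖x‖ ^ d)⁻¹ * fderiv ℝ φ x x := by
  have hx' : 0 < ‖x‖ := norm_pos_iff.2 hx
  rw [(hasGradientAt_comp_norm hx (hF _ hx')).gradient, ← hflux _ hx', norm_smul, inner_smul_left,
    inner_gradient_right]
  obtain ⟨k, rfl⟩ := Nat.exists_eq_add_of_le hd
  have : 2 + k - 1 = k + 1 := by omega
  simp only [norm_mul, norm_inv, Real.norm_eq_abs,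
    Nat.add_sub_cancel_left, this]
  simp
  field_simp
  ring

/-- Along a ray, the flux identity for a radial profile is the fundamental theorem of calculus. -/
theorem integral_Ioi_flux_sub_exp_mul {F q : ℝ → ℝ} {k : ℕ} {C l : ℝ}
    (hq0 : ContinuousWithinAt q (Ici 0) 0)
    (hq : ∀ r, 0 < r → HasDerivAt q (-(r ^ k * Real.exp (F r))) r)
    (hlim : Tendsto q atTop (𝓝 l)) (hC : ∀ r, 0 < r → |q r| ≤ C)
    {φ : E → ℝ} (hφ : ContDiff ℝ 1 φ) (hφc : HasCompactSupport φ) {θ : E} (hθ : ‖θ‖ = 1) :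
    ∫ r in Ioi (0 : ℝ), (q r * fderiv ℝ φ (r • θ) θ - r ^ k * Real.exp (F r) * φ (r • θ)) =
      -(q 0 * φ 0) := by
  have hcont : ContinuousOn q (Ioi 0) := fun r hr => (hq r hr).continuousAt.continuousWithinAt
  set ψ : ℝ → ℝ := fun r => φ (r • θ) with hψ
  have hψd : ∀ r, HasDerivAt ψ (fderiv ℝ φ (r • θ) θ) r := fun r => by
    have h1 : HasDerivAt (fun r : ℝ => r • θ) θ r := by
      simpa using (hasDerivAt_id r).smul_const θ
    exact ((hφ.differentiable one_ne_zero (r • θ)).hasFDerivAt).comp_hasDerivAt r h1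
  have hψc : HasCompactSupport ψ := by
    refine hφc.comp_isClosedEmbedding (f := φ) (g := fun r : ℝ => r • θ) ?_
    refine (Isometry.of_dist_eq fun a b => ?_).isClosedEmbedding
    rw [dist_eq_norm, ← sub_smul, norm_smul, hθ, mul_one, dist_eq_norm]
  have hψ1 : ContDiff ℝ 1 ψ := hφ.comp (contDiff_id.smul contDiff_const)
  have hderiv : deriv ψ = fun r => fderiv ℝ φ (r • θ) θ := funext fun r => (hψd r).deriv
  have hdi : Integrable (fun r : ℝ => fderiv ℝ φ (r • θ) θ) := by
    rw [← hderiv]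
    exact (hψ1.continuous_deriv le_rfl).integrable_of_hasCompactSupport hψc.deriv
  obtain ⟨M, hM⟩ := hψc.exists_bound_of_continuous hψ1.continuous
  have hψ0 : Tendsto ψ atTop (𝓝 0) := by
    have h := hψc
    rw [hasCompactSupport_iff_eventuallyEq, Filter.coclosedCompact_eq_cocompact] at h
    exact (h.filter_mono _root_.atTop_le_cocompact).tendsto
  have hi1 : IntegrableOn (fun r => q r * fderiv ℝ φ (r • θ) θ) (Ioi 0) := by
    refine hdi.integrableOn.bdd_mul (hcont.aestronglyMeasurable measurableSet_Ioi) (c := C) ?_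
    filter_upwards [ae_restrict_mem measurableSet_Ioi] with r hr using hC r hr
  have hi2 : IntegrableOn (fun r => r ^ k * Real.exp (F r) * ψ r) (Ioi 0) := by
    have h := (integrableOn_Ioi_deriv_of_nonpos hq0 hq (fun r hr => neg_nonpos.2 <| mul_nonneg
      (pow_nonneg (mem_Ioi.1 hr).le _) (Real.exp_pos _).le) hlim).neg
    simp only [Pi.neg_def, neg_neg] at h
    exact h.mul_bdd hψ1.continuous.aestronglyMeasurable (.of_forall hM)
  have key := integral_Ioi_of_hasDerivAt_of_tendsto (f := fun r => q r * ψ r)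
    (f' := fun r => q r * fderiv ℝ φ (r • θ) θ - r ^ k * Real.exp (F r) * ψ r)
    (hq0.mul hψ1.continuous.continuousWithinAt)
    (fun r hr => ((hq r hr).mul (hψd r)).congr_deriv (by ring)) (hi1.sub hi2) (hlim.mul hψ0)
  rw [key]
  simp [hψ]

variable [FiniteDimensional ℝ E] [MeasurableSpace E] [BorelSpace E]

/-- The exponential of a radial profile with finite total flux is integrable. -/
theorem integrable_exp_comp_norm [Nontrivial E] (μ : Measure E) [μ.IsAddHaarMeasure]
    {F q : ℝ → ℝ} {l : ℝ} (hq0 : ContinuousWithinAt q (Ici 0) 0)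
    (hq : ∀ r, 0 < r → HasDerivAt q (-(r ^ (Module.finrank ℝ E - 1) * Real.exp (F r))) r)
    (hlim : Tendsto q atTop (𝓝 l)) :
    Integrable (fun x : E => Real.exp (F ‖x‖)) μ := by
  rw [integrable_fun_norm_addHaar μ (f := fun r => Real.exp (F r))]
  have h := (integrableOn_Ioi_deriv_of_nonpos hq0 hq (fun r hr => neg_nonpos.2 <| mul_nonneg
      (pow_nonneg (mem_Ioi.1 hr).le _) (Real.exp_pos _).le) hlim).neg
  simpa only [Pi.neg_def, neg_neg, smul_eq_mul] using h

/-- A radial profile `F` whose flux `q` has derivative `-r ^ (n - 1) * exp (F r)` solves the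
singular `n`-Liouville equation in the weak sense. -/
theorem integral_norm_gradient_pow_mul_inner_eq (μ : Measure E) [μ.IsAddHaarMeasure]
    (hd : 2 ≤ Module.finrank ℝ E) {F F' q : ℝ → ℝ} {C l : ℝ}
    (hq0 : ContinuousWithinAt q (Ici 0) 0)
    (hq : ∀ r, 0 < r → HasDerivAt q (-(r ^ (Module.finrank ℝ E - 1) * Real.exp (F r))) r)
    (hlim : Tendsto q atTop (𝓝 l)) (hC : ∀ r, 0 < r → |q r| ≤ C)
    (hF : ∀ r, 0 < r → HasDerivAt F (F' r) r)
    (hflux : ∀ r, 0 < r →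
      |F' r| ^ (Module.finrank ℝ E - 2) * F' r * r ^ (Module.finrank ℝ E - 1) = q r)
    {φ : E → ℝ} (hφ : ContDiff ℝ 1 φ) (hφc : HasCompactSupport φ) :
    ∫ x, ‖gradient (fun y : E => F ‖y‖) x‖ ^ (Module.finrank ℝ E - 2) *
        ⟪gradient (fun y : E => F ‖y‖) x, gradient φ x⟫_ℝ ∂μ =
      (∫ x, Real.exp (F ‖x‖) * φ x ∂μ) - μ.toSphere.real univ * q 0 * φ 0 := by
  have : Nontrivial E := Module.nontrivial_of_finrank_pos (R := ℝ) (by omega)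
  set d := Module.finrank ℝ E with hdd
  have hcont : ContinuousOn q (Ioi 0) := fun r hr => (hq r hr).continuousAt.continuousWithinAt
  have hC0 : 0 ≤ C := (abs_nonneg _).trans (hC 1 one_pos)
  set G : E → ℝ := fun x => q ‖x‖ * (‖x‖ ^ d)⁻¹ * fderiv ℝ φ x x with hG
  have hne : ∀ᵐ x ∂μ, x ≠ 0 := by simp [ae_iff]
  have hGeq : (fun x => ‖gradient (fun y : E => F ‖y‖) x‖ ^ (d - 2) *
      ⟪gradient (fun y : E => F ‖y‖) x, gradient φ x⟫_ℝ) =ᵐ[μ] G := by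
    filter_upwards [hne] with x hx using norm_gradient_pow_mul_inner hd hF hflux hx φ
  have hφ' : Continuous (fderiv ℝ φ) := hφ.continuous_fderiv one_ne_zero
  obtain ⟨M, hM⟩ := (hφc.fderiv ℝ).exists_bound_of_continuous hφ'
  obtain ⟨N, hN⟩ := hφc.exists_bound_of_continuous hφ.continuous
  obtain ⟨R, hR⟩ := (hφc.fderiv ℝ).isCompact.isBounded.subset_ball (0 : E)
  have hGi : Integrable G μ := by
    have hpow : IntegrableOn (fun x : E => C * M * (‖x‖ ^ (d - 1))⁻¹) (ball 0 R) μ := by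
      rw [integrableOn_fun_norm_addHaar μ (f := fun r => C * M * (r ^ (d - 1))⁻¹)]
      refine ((integrableOn_const (C := C * M)
        (measure_Ioo_lt_top (a := (0 : ℝ)) (b := R)).ne)).congr_fun (fun r hr => ?_)
        measurableSet_Ioo
      have : r ^ (d - 1) ≠ 0 := pow_ne_zero _ hr.1.ne'
      simp only [← hdd, smul_eq_mul]
      field_simp
    refine (hpow.integrable_indicator measurableSet_ball).mono' ?_ ?_
    · rw [← restrict_compl_singleton (μ := μ) (0 : E)]
      refine ContinuousOn.aestronglyMeasurable ?_ (measurableSet_singleton _).compl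
      refine ((hcont.comp continuous_norm.continuousOn fun x hx => norm_pos_iff.2 hx).mul
        (ContinuousOn.inv₀ (by fun_prop) fun x hx => pow_ne_zero _ (norm_ne_zero_iff.2 hx))).mul
        (hφ'.clm_apply continuous_id).continuousOn
    · filter_upwards [hne] with x hx
      have hx' : 0 < ‖x‖ := norm_pos_iff.2 hx
      by_cases hxR : x ∈ ball (0 : E) R
      · rw [indicator_of_mem hxR]
        have hxd : (‖x‖ ^ (d - 1))⁻¹ = (‖x‖ ^ d)⁻¹ * ‖x‖ := by
          obtain ⟨k, hk⟩ := Nat.exists_eq_add_of_le' (one_le_two.trans hd)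
          rw [hk, Nat.add_sub_cancel, pow_succ]
          field_simp
        calc ‖G x‖ = |q ‖x‖| * (‖x‖ ^ d)⁻¹ * ‖fderiv ℝ φ x x‖ := by
              simp [hG]
          _ ≤ C * (‖x‖ ^ d)⁻¹ * (M * ‖x‖) := by
              gcongr
              · exact hC _ hx'
              · exact (fderiv ℝ φ x).le_of_opNorm_le (hM x) x
          _ = _ := by rw [hxd]; ring
      · have : fderiv ℝ φ x = 0 := image_eq_zero_of_notMem_tsupport fun h => hxR (hR h)
        rw [indicator_of_notMem hxR]
        simp [hG, this]
  have hei : Integrable (fun x => Real.exp (F ‖x‖) * φ x) μ :=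
    (integrable_exp_comp_norm μ hq0 hq hlim).mul_bdd hφ.continuous.aestronglyMeasurable
      (.of_forall hN)
  have key : ∫ x, (G x - Real.exp (F ‖x‖) * φ x) ∂μ = -(μ.toSphere.real univ * q 0 * φ 0) := by
    rw [integral_eq_integral_sphere_integral_Ioi μ
      (D := fun x => G x - Real.exp (F ‖x‖) * φ x) (hGi.sub hei)]
    have hray : ∀ θ : sphere (0 : E) 1, ∫ r in Ioi (0 : ℝ), r ^ (d - 1) *
        (G (r • (θ : E)) - Real.exp (F ‖r • (θ : E)‖) * φ (r • (θ : E))) = -(q 0 * φ 0) := by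
      intro θ
      have hθ : ‖(θ : E)‖ = 1 := by simp
      rw [← integral_Ioi_flux_sub_exp_mul hq0 hq hlim hC hφ hφc hθ]
      refine setIntegral_congr_fun measurableSet_Ioi fun r hr => ?_
      have hr : 0 < r := hr
      obtain ⟨k, hk⟩ := Nat.exists_eq_add_of_le' (one_le_two.trans hd)
      simp only [hG, norm_smul, hθ, mul_one, Real.norm_eq_abs, abs_of_pos hr, map_smul,
        smul_eq_mul, hk, Nat.add_sub_cancel]
      field_simp
      ring
    refine (integral_congr_ae (.of_forall hray)).trans ?_
    simp [mul_assoc]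
  rw [integral_sub hGi hei] at key
  rw [integral_congr_ae hGeq]
  linarith

end Polar

section AutonomousODE

/-- A scalar autonomous ODE `dp/dt = -h p` with `h` positive on `(a, b)` and degenerating at most
linearly at the endpoints has a global solution joining `b` to `a`. -/
theorem exists_solution_autonomous {h : ℝ → ℝ} {a b c K : ℝ} (hc : c ∈ Ioo a b)
    (hcont : ContinuousOn h (Ioo a b)) (hpos : ∀ x ∈ Ioo a b, 0 < h x)
    (ha : ∀ x ∈ Ioo a b, h x ≤ K * (x - a)) (hb : ∀ x ∈ Ioo a b, h x ≤ K * (b - x)) :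
    ∃ p : ℝ → ℝ, p 0 = c ∧ (∀ t, p t ∈ Ioo a b) ∧ (∀ t, HasDerivAt p (-h (p t)) t) ∧
      Tendsto p atBot (𝓝 b) ∧ Tendsto p atTop (𝓝 a) := by
  have hK : 0 < K := pos_of_mul_pos_left ((hpos c hc).trans_le (ha c hc)) (sub_pos.2 hc.1).le
  have hginv : ContinuousOn (fun x => -(h x)⁻¹) (Ioo a b) :=
    (hcont.inv₀ fun x hx => (hpos x hx).ne').neg
  set T : ℝ → ℝ := fun x => ∫ s in c..x, -(h s)⁻¹ with hT
  have hTc : T c = 0 := intervalIntegral.integral_same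
  have hTd : ∀ x ∈ Ioo a b, HasDerivAt T (-(h x)⁻¹) x := fun x hx => by
    refine intervalIntegral.integral_hasDerivAt_right
      ((hginv.mono (ordConnected_Ioo.uIcc_subset hc hx)).intervalIntegrable)
      (hginv.stronglyMeasurableAtFilter isOpen_Ioo x hx)
      (hginv.continuousAt (isOpen_Ioo.mem_nhds hx))
  have hTcont : ContinuousOn T (Ioo a b) := fun x hx => (hTd x hx).continuousAt.continuousWithinAt
  have hanti : StrictAntiOn T (Ioo a b) := by
    refine strictAntiOn_of_deriv_neg (convex_Ioo a b) hTcont fun x hx => ?_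
    rw [interior_Ioo] at hx
    rw [(hTd x hx).deriv]
    exact neg_neg_of_pos (inv_pos.2 (hpos x hx))
  -- comparison with logarithms at the two endpoints
  have hlogb : AntitoneOn (fun x => T x - K⁻¹ * Real.log (b - x)) (Ioo a b) := by
    have hd : ∀ x ∈ Ioo a b, HasDerivAt (fun x => T x - K⁻¹ * Real.log (b - x))
        (-(h x)⁻¹ - K⁻¹ * (-1 / (b - x))) x := fun x hx =>
      (hTd x hx).sub ((((hasDerivAt_id x).const_sub b).log (sub_pos.2 hx.2).ne').const_mul _)
    refine antitoneOn_of_deriv_nonpos (convex_Ioo a b)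
      (fun x hx => (hd x hx).continuousAt.continuousWithinAt)
      (fun x hx => (hd x (interior_subset hx)).differentiableAt.differentiableWithinAt)
      fun x hx => ?_
    replace hx := interior_subset hx
    rw [(hd x hx).deriv]
    have := inv_anti₀ (hpos x hx) (hb x hx)
    rw [mul_inv] at this
    rw [neg_div, one_div]
    linarith
  have hloga : AntitoneOn (fun x => T x + K⁻¹ * Real.log (x - a)) (Ioo a b) := by
    have hd : ∀ x ∈ Ioo a b, HasDerivAt (fun x => T x + K⁻¹ * Real.log (x - a))
        (-(h x)⁻¹ + K⁻¹ * (1 / (x - a))) x := fun x hx =>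
      (hTd x hx).add ((((hasDerivAt_id x).sub_const a).log (sub_pos.2 hx.1).ne').const_mul _)
    refine antitoneOn_of_deriv_nonpos (convex_Ioo a b)
      (fun x hx => (hd x hx).continuousAt.continuousWithinAt)
      (fun x hx => (hd x (interior_subset hx)).differentiableAt.differentiableWithinAt)
      fun x hx => ?_
    replace hx := interior_subset hx
    rw [(hd x hx).deriv]
    have := inv_anti₀ (hpos x hx) (ha x hx)
    rw [mul_inv] at this
    rw [one_div]
    linarith
  have hlow : ∀ t, ∃ x ∈ Ioo a b, T x ≤ t := by
    intro t
    have h1 : Tendsto (fun x => K⁻¹ * Real.log (b - x) + (T c - K⁻¹ * Real.log (b - c)))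
        (𝓝[<] b) atBot := by
      refine tendsto_atBot_add_const_right _ _ (Tendsto.const_mul_atBot (inv_pos.2 hK) ?_)
      refine Real.tendsto_log_nhdsGT_zero.comp ?_
      refine tendsto_nhdsWithin_iff.2 ⟨?_, ?_⟩
      · have : Tendsto (fun x : ℝ => b - x) (𝓝 b) (𝓝 (b - b)) := tendsto_id.const_sub b
        rw [sub_self] at this
        exact this.mono_left nhdsWithin_le_nhds
      · filter_upwards [self_mem_nhdsWithin] with x hx using sub_pos.2 (mem_Iio.1 hx)
    obtain ⟨x, hxt, hx⟩ := ((h1.eventually_le_atBot t).and (Ioo_mem_nhdsLT hc.2)).exists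
    have hx' : x ∈ Ioo a b := ⟨hc.1.trans hx.1, hx.2⟩
    have := hlogb hc hx' hx.1.le
    exact ⟨x, hx', by simp only at this; linarith⟩
  have hhigh : ∀ t, ∃ x ∈ Ioo a b, t ≤ T x := by
    intro t
    have h1 : Tendsto (fun x => K⁻¹ * Real.log (x - a) + (-t - (T c + K⁻¹ * Real.log (c - a))))
        (𝓝[>] a) atBot := by
      refine tendsto_atBot_add_const_right _ _ (Tendsto.const_mul_atBot (inv_pos.2 hK) ?_)
      refine Real.tendsto_log_nhdsGT_zero.comp ?_
      refine tendsto_nhdsWithin_iff.2 ⟨?_, ?_⟩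
      · have : Tendsto (fun x : ℝ => x - a) (𝓝 a) (𝓝 (a - a)) := tendsto_id.sub_const a
        rw [sub_self] at this
        exact this.mono_left nhdsWithin_le_nhds
      · filter_upwards [self_mem_nhdsWithin] with x hx using sub_pos.2 (mem_Ioi.1 hx)
    obtain ⟨x, hxt, hx⟩ :=
      ((h1.eventually_le_atBot (-2 * t)).and (Ioo_mem_nhdsGT hc.1)).exists
    have hx' : x ∈ Ioo a b := ⟨hx.1, hx.2.trans hc.2⟩
    have := hloga hx' hc hx.2.le
    exact ⟨x, hx', by simp only at this; linarith⟩
  have hsurj : ∀ t, ∃ x ∈ Ioo a b, T x = t := by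
    intro t
    obtain ⟨x, hx, hxt⟩ := hlow t
    obtain ⟨y, hy, hyt⟩ := hhigh t
    exact isPreconnected_Ioo.intermediate_value hx hy hTcont ⟨hxt, hyt⟩
  choose p hpm hpT using hsurj
  have hTp : ∀ x ∈ Ioo a b, p (T x) = x := fun x hx => hanti.injOn (hpm _) hx (hpT _)
  have hpa : ∀ t, ∀ x ∈ Ioo a b, p t < x ↔ T x < t := fun t x hx => by
    rw [← hanti.lt_iff_gt hx (hpm t), hpT]
  have hpb : ∀ t, ∀ x ∈ Ioo a b, x < p t ↔ t < T x := fun t x hx => by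
    rw [← hanti.lt_iff_gt (hpm t) hx, hpT]
  refine ⟨p, ?_, hpm, fun t => ?_, ?_, ?_⟩
  · rw [← hTc, hTp c hc]
  · have hpc : ContinuousAt p t := by
      refine tendsto_order.2 ⟨fun y hy => ?_, fun y hy => ?_⟩
      · obtain ⟨x, hx1, hx2⟩ := exists_between (max_lt hy (hpm t).1)
        have hx : x ∈ Ioo a b := ⟨(le_max_right _ _).trans_lt hx1, hx2.trans (hpm t).2⟩
        filter_upwards [Iio_mem_nhds ((hpb t x hx).1 hx2)] with s hs
        exact ((le_max_left _ _).trans_lt hx1).trans ((hpb s x hx).2 hs)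
      · obtain ⟨x, hx1, hx2⟩ := exists_between (lt_min hy (hpm t).2)
        have hx : x ∈ Ioo a b := ⟨(hpm t).1.trans hx1, hx2.trans_le (min_le_right _ _)⟩
        filter_upwards [Ioi_mem_nhds ((hpa t x hx).1 hx1)] with s hs
        exact ((hpa s x hx).2 hs).trans (hx2.trans_le (min_le_left _ _))
    refine (HasDerivAt.of_local_left_inverse hpc (hTd _ (hpm t))
      (neg_ne_zero.2 (inv_ne_zero (hpos _ (hpm t)).ne')) (.of_forall hpT)).congr_deriv ?_
    rw [inv_neg, inv_inv]
  · refine tendsto_order.2 ⟨fun y hy => ?_, fun y hy => .of_forall fun t => (hpm t).2.trans hy⟩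
    obtain ⟨x, hx1, hx2⟩ := exists_between (max_lt hy (hc.1.trans hc.2))
    have hx : x ∈ Ioo a b := ⟨(le_max_right _ _).trans_lt hx1, hx2⟩
    filter_upwards [Iio_mem_atBot (T x)] with s hs
    exact ((le_max_left _ _).trans_lt hx1).trans ((hpb s x hx).2 hs)
  · refine tendsto_order.2 ⟨fun y hy => .of_forall fun t => hy.trans (hpm t).1, fun y hy => ?_⟩
    obtain ⟨x, hx1, hx2⟩ := exists_between (lt_min hy (hc.1.trans hc.2))
    have hx : x ∈ Ioo a b := ⟨hx1, hx2.trans_le (min_le_right _ _)⟩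
    filter_upwards [Ioi_mem_atTop (T x)] with s hs
    exact ((hpa s x hx).2 hs).trans (hx2.trans_le (min_le_left _ _))

end AutonomousODE

section Profile

/-- The largest zero of a `C¹` function to the left of an interval of positivity, together with
linear upper bounds at both endpoints. -/
theorem exists_left_zero_linear_bounds {h : ℝ → ℝ} (hC1 : ContDiff ℝ 1 h) {y c b : ℝ} (hyc : y < c)
    (hcb : c < b) (hy : h y ≤ 0) (hb : h b = 0) (hpos : ∀ x ∈ Ico c b, 0 < h x) :
    ∃ a K : ℝ, a < c ∧ ∀ x ∈ Ioo a b, 0 < h x ∧ h x ≤ K * (x - a) ∧ h x ≤ K * (b - x) := by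
  set S : Set ℝ := Iic c ∩ {x | h x ≤ 0}
  have hSc : IsClosed S := isClosed_Iic.inter (isClosed_le hC1.continuous continuous_const)
  have hSb : BddAbove S := ⟨c, fun x hx => hx.1⟩
  have ha : sSup S ∈ S := hSc.csSup_mem ⟨y, hyc.le, hy⟩ hSb
  set a := sSup S
  have hac : a < c := lt_of_le_of_ne ha.1 fun hac => by
    have := ha.2
    rw [mem_ofPred_eq, hac] at this
    exact absurd (hpos c ⟨le_rfl, hcb⟩) this.not_gt
  obtain ⟨K, hK⟩ := isCompact_Icc.exists_bound_of_continuousOn (s := Icc a b)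
    (hC1.continuous_deriv le_rfl).continuousOn
  have hlip : ∀ x ∈ Icc a b, ∀ z ∈ Icc a b, ‖h z - h x‖ ≤ K * ‖z - x‖ := fun x hx z hz =>
    (convex_Icc a b).norm_image_sub_le_of_norm_deriv_le
      (fun w _ => hC1.differentiable one_ne_zero w) hK hx hz
  have hab : a ≤ b := (hac.trans hcb).le
  refine ⟨a, K, hac, fun x hx => ⟨?_, ?_, ?_⟩⟩
  · by_cases hxc : x ≤ c
    · by_contra! hneg
      exact (le_csSup hSb ⟨hxc, hneg⟩).not_gt hx.1
    · exact hpos x ⟨(not_le.1 hxc).le, hx.2⟩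
  · have h1 := hlip a (left_mem_Icc.2 hab) x (Ioo_subset_Icc_self hx)
    rw [Real.norm_eq_abs, Real.norm_eq_abs, abs_of_pos (sub_pos.2 hx.1)] at h1
    have h2 : h a ≤ 0 := ha.2
    linarith [le_abs_self (h x - h a)]
  · have h1 := hlip b (right_mem_Icc.2 hab) x (Ioo_subset_Icc_self hx)
    rw [Real.norm_eq_abs, Real.norm_eq_abs, abs_sub_comm x b, abs_of_pos (sub_pos.2 hx.2), hb,
      sub_zero] at h1
    exact (le_abs_self _).trans h1

/-- The inverse of the odd power `x ↦ |x| ^ (n - 2) * x`. -/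
noncomputable def fluxInv (n : ℕ) (x : ℝ) : ℝ :=
  |x| ^ ((n : ℝ) / (n - 1) - 2) * x

/-- A primitive of `x ↦ n + fluxInv n x`. -/
noncomputable def fluxPotential (n : ℕ) (x : ℝ) : ℝ :=
  n * x + ((n : ℝ) / (n - 1))⁻¹ * |x| ^ ((n : ℝ) / (n - 1))

variable {n : ℕ}

theorem one_lt_div_sub_one (hn : 2 ≤ n) : (1 : ℝ) < n / (n - 1) := by
  have : (2 : ℝ) ≤ n := by exact_mod_cast hn
  rw [lt_div_iff₀ (by linarith)]
  linarith

theorem abs_fluxInv_pow_mul (hn : 2 ≤ n) (x : ℝ) :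
    |fluxInv n x| ^ (n - 2) * fluxInv n x = x := by
  rcases eq_or_ne x 0 with rfl | hx
  · simp [fluxInv]
  have hx' : 0 < |x| := abs_pos.2 hx
  have hn' : (2 : ℝ) ≤ n := by exact_mod_cast hn
  have h1 : |fluxInv n x| = |x| ^ ((n : ℝ) / (n - 1) - 1) := by
    rw [fluxInv, abs_mul, abs_of_nonneg (Real.rpow_nonneg hx'.le _), ← Real.rpow_add_one hx'.ne']
    ring_nf
  rw [h1, fluxInv, ← Real.rpow_mul_natCast hx'.le, ← mul_assoc, ← Real.rpow_add hx',
    Nat.cast_sub hn]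
  have : ((n : ℝ) / (n - 1) - 1) * ((n : ℝ) - (2 : ℕ)) + (n / (n - 1) - 2) = 0 := by
    have : (n : ℝ) - 1 ≠ 0 := by linarith
    push_cast
    field_simp
    ring
  rw [this, Real.rpow_zero, one_mul]

theorem fluxInv_pos {x : ℝ} (hx : 0 < x) : 0 < fluxInv n x :=
  mul_pos (Real.rpow_pos_of_pos (abs_pos.2 hx.ne') _) hx

theorem fluxInv_neg {x : ℝ} (hx : x < 0) : fluxInv n x < 0 :=
  mul_neg_of_pos_of_neg (Real.rpow_pos_of_pos (abs_pos.2 hx.ne) _) hx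

theorem hasDerivAt_fluxPotential (hn : 2 ≤ n) (x : ℝ) :
    HasDerivAt (fluxPotential n) (n + fluxInv n x) x := by
  have hp := one_lt_div_sub_one hn
  refine (((hasDerivAt_id x).const_mul (n : ℝ)).add
    ((hasDerivAt_abs_rpow x hp).const_mul _)).congr_deriv ?_
  rw [mul_one, fluxInv, mul_assoc _ _ x, inv_mul_cancel_left₀ (by linarith)]

theorem contDiff_fluxPotential (hn : 2 ≤ n) : ContDiff ℝ 1 (fluxPotential n) := by
  have h := contDiff_norm_rpow (E := ℝ) (one_lt_div_sub_one hn)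
  simp only [Real.norm_eq_abs] at h
  exact (contDiff_const.mul contDiff_id).add (contDiff_const.mul h)

theorem continuous_fluxInv (hn : 2 ≤ n) : Continuous (fluxInv n) := by
  have h := ((contDiff_fluxPotential hn).continuous_deriv le_rfl).sub
    (continuous_const (y := (n : ℝ)))
  refine h.congr fun x => ?_
  rw [Pi.sub_apply, (hasDerivAt_fluxPotential hn x).deriv, add_sub_cancel_left]

theorem exists_neg_le_fluxPotential (hn : 2 ≤ n) (M : ℝ) : ∃ y < 0, M ≤ fluxPotential n y := by
  have hp := one_lt_div_sub_one hn
  set p := (n : ℝ) / (n - 1) with hpdef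
  have hlim : Tendsto (fun x : ℝ => x * (p⁻¹ * x ^ (p - 1) - n)) atTop atTop := by
    refine tendsto_id.atTop_mul_atTop₀ (tendsto_atTop_add_const_right _ _ ?_)
    exact (tendsto_rpow_atTop (by linarith)).const_mul_atTop (inv_pos.2 (by linarith))
  obtain ⟨x, hxM, hx⟩ := ((hlim.eventually_ge_atTop M).and (eventually_gt_atTop 0)).exists
  refine ⟨-x, neg_neg_of_pos hx, hxM.trans_eq ?_⟩
  rw [fluxPotential, ← hpdef, abs_neg, abs_of_pos hx]
  nth_rw 4 [← sub_add_cancel p 1]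
  rw [Real.rpow_add_one hx.ne']
  ring

/-- Existence of a radial profile, increasing then decreasing, whose flux `q` starts from `A` at the
origin and satisfies the radial `n`-Liouville equation. -/
theorem exists_radial_profile (hn : 2 ≤ n) {A : ℝ} (hA : 0 < A) :
    ∃ (f f' q : ℝ → ℝ) (C l : ℝ), q 0 = A ∧ ContinuousWithinAt q (Ici 0) 0 ∧
      (∀ r, 0 < r → HasDerivAt q (-(r ^ (n - 1) * Real.exp (f r))) r) ∧
      Tendsto q atTop (𝓝 l) ∧ (∀ r, 0 < r → |q r| ≤ C) ∧
      (∀ r, 0 < r → HasDerivAt f (f' r) r) ∧ ContinuousOn f' (Ioi 0) ∧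
      (∀ r, 0 < r → |f' r| ^ (n - 2) * f' r * r ^ (n - 1) = q r) ∧
      (∀ r ∈ Ioo 0 1, 0 < f' r) ∧ ∀ r ∈ Ioi 1, f' r < 0 := by
  set h : ℝ → ℝ := fun x => fluxPotential n A - fluxPotential n x
  have hC1 : ContDiff ℝ 1 h := contDiff_const.sub (contDiff_fluxPotential hn)
  have hd : ∀ x, HasDerivAt h (-(n + fluxInv n x)) x := fun x =>
    (hasDerivAt_fluxPotential hn x).const_sub _
  have hmono : StrictMonoOn (fluxPotential n) (Ici 0) := by
    refine strictMonoOn_of_deriv_pos (convex_Ici 0)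
      (contDiff_fluxPotential hn).continuous.continuousOn fun x hx => ?_
    rw [interior_Ici] at hx
    rw [(hasDerivAt_fluxPotential hn x).deriv]
    exact add_pos_of_nonneg_of_pos (Nat.cast_nonneg _) (fluxInv_pos hx)
  obtain ⟨y, hy0, hy⟩ := exists_neg_le_fluxPotential hn (fluxPotential n A)
  obtain ⟨a, K, ha0, haK⟩ := exists_left_zero_linear_bounds hC1 hy0 hA (sub_nonpos.2 hy)
    (sub_self _) fun x hx => sub_pos.2 (hmono hx.1 hA.le hx.2)
  obtain ⟨p, hp0, hpm, hpd, hpbot, hptop⟩ := exists_solution_autonomous (c := 0) ⟨ha0, hA⟩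
    hC1.continuous.continuousOn (fun x hx => (haK x hx).1) (fun x hx => (haK x hx).2.1)
    (fun x hx => (haK x hx).2.2)
  have hhp : ∀ t, 0 < h (p t) := fun t => (haK _ (hpm t)).1
  have hanti : StrictAnti p := strictAnti_of_deriv_neg fun t => by
    rw [(hpd t).deriv]
    exact neg_neg_of_pos (hhp t)
  have hpc : Continuous p := continuous_iff_continuousAt.2 fun t => (hpd t).continuousAt
  have hexp : ∀ r, 0 < r →
      r ^ (n - 1) * Real.exp (Real.log (h (p (Real.log r))) - n * Real.log r) =
        h (p (Real.log r)) * r⁻¹ := fun r hr => by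
    rw [Real.exp_sub, Real.exp_log (hhp _), Real.exp_nat_mul, Real.exp_log hr]
    obtain ⟨k, hk⟩ := Nat.exists_eq_add_of_le' (one_le_two.trans hn)
    rw [hk, Nat.add_sub_cancel, pow_succ]
    field_simp
  have hq : ∀ r, 0 < r → (fun r => if r ≤ 0 then A else p (Real.log r)) =ᶠ[𝓝 r]
      fun r => p (Real.log r) := fun r hr => by
    filter_upwards [Ioi_mem_nhds hr] with s hs using if_neg (not_le.2 hs)
  refine ⟨fun r => Real.log (h (p (Real.log r))) - n * Real.log r,
    fun r => fluxInv n (p (Real.log r)) * r⁻¹, fun r => if r ≤ 0 then A else p (Real.log r),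
    max |a| |A|, a, if_pos le_rfl, ?_, fun r hr => ?_, ?_, fun r hr => ?_, fun r hr => ?_, ?_,
    fun r hr => ?_, fun r hr => ?_, fun r hr => ?_⟩
  · rw [← continuousWithinAt_Ioi_iff_Ici, ContinuousWithinAt, if_pos le_rfl]
    refine (hpbot.comp Real.tendsto_log_nhdsGT_zero).congr' ?_
    filter_upwards [self_mem_nhdsWithin] with s hs using (if_neg (not_le.2 hs)).symm
  · rw [hexp r hr, ← neg_mul]
    exact ((hpd _).comp r (Real.hasDerivAt_log hr.ne')).congr_of_eventuallyEq (hq r hr)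
  · refine (hptop.comp Real.tendsto_log_atTop).congr' ?_
    filter_upwards [eventually_gt_atTop 0] with s hs using (if_neg (not_le.2 hs)).symm
  · simp only [if_neg (not_le.2 hr)]
    exact abs_le_max_abs_abs (hpm _).1.le (hpm _).2.le
  · have h1 := (((hd _).comp r ((hpd _).comp r (Real.hasDerivAt_log hr.ne'))).log (hhp _).ne').sub
      ((Real.hasDerivAt_log hr.ne').const_mul (n : ℝ))
    refine h1.congr_deriv ?_
    have := (hhp (Real.log r)).ne'
    simp only [Function.comp_apply]
    field_simp
    ring
  · refine ((continuous_fluxInv hn).comp_continuousOn (hpc.comp_continuousOn ?_)).mul ?_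
    · exact Real.continuousOn_log.mono fun x hx => (mem_Ioi.1 hx).ne'
    · exact continuousOn_inv₀.mono fun x hx => (mem_Ioi.1 hx).ne'
  · simp only [if_neg (not_le.2 hr)]
    conv_rhs => rw [← abs_fluxInv_pow_mul hn (p (Real.log r))]
    rw [abs_mul, abs_of_pos (inv_pos.2 hr), mul_pow, inv_pow]
    obtain ⟨k, rfl⟩ := Nat.exists_eq_add_of_le' hn
    have : k + 2 - 1 = k + 1 := by omega
    rw [this, Nat.add_sub_cancel, pow_succ r]
    field_simp
  · refine mul_pos (fluxInv_pos ?_) (inv_pos.2 hr.1)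
    rw [← hp0]
    exact hanti (Real.log_neg hr.1 hr.2)
  · refine mul_neg_of_neg_of_pos (fluxInv_neg ?_) (inv_pos.2 (one_pos.trans hr))
    rw [← hp0]
    exact hanti (Real.log_pos hr)

end Profile

theorem radial_solutions_singular_n_Liouville
    (n : ℕ) (hn : 2 ≤ n) (γ : ℝ) (hγ : 0 < γ) :
    ∃ f : ℝ → ℝ, ContDiffOn ℝ 1 f (Ioi 0) ∧
      ContDiffOn ℝ 1 (fun x : EuclideanSpace ℝ (Fin n) => f ‖x‖)
        {(0 : EuclideanSpace ℝ (Fin n))}ᶜ ∧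
      Integrable (fun x : EuclideanSpace ℝ (Fin n) => Real.exp (f ‖x‖)) ∧
      (∀ φ : EuclideanSpace ℝ (Fin n) → ℝ, ContDiff ℝ 1 φ → HasCompactSupport φ →
        ∫ x, ‖gradient (fun y : EuclideanSpace ℝ (Fin n) => f ‖y‖) x‖ ^ (n - 2) *
            ⟪gradient (fun y : EuclideanSpace ℝ (Fin n) => f ‖y‖) x, gradient φ x⟫_ℝ
          = (∫ x : EuclideanSpace ℝ (Fin n), Real.exp (f ‖x‖) * φ x) - γ * φ 0) ∧
      StrictMonoOn f (Ioo 0 1) ∧ StrictAntiOn f (Ioi 1) ∧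
      (∀ r ∈ Ioi (0 : ℝ), f r ≤ f 1) ∧
      ∀ lam : ℝ, 0 < lam →
        (∀ φ : EuclideanSpace ℝ (Fin n) → ℝ, ContDiff ℝ 1 φ → HasCompactSupport φ →
          ∫ x, ‖gradient (fun y : EuclideanSpace ℝ (Fin n) =>
                f (lam * ‖y‖) + n * Real.log lam) x‖ ^ (n - 2) *
              ⟪gradient (fun y : EuclideanSpace ℝ (Fin n) =>
                f (lam * ‖y‖) + n * Real.log lam) x, gradient φ x⟫_ℝ
            = (∫ x : EuclideanSpace ℝ (Fin n),
                Real.exp (f (lam * ‖x‖) + n * Real.log lam) * φ x) - γ * φ 0) ∧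
        ∀ r ∈ Ioi (0 : ℝ), r ≠ 1 / lam →
          f (lam * r) + n * Real.log lam < f (lam * (1 / lam)) + n * Real.log lam := by
  have hdim : Module.finrank ℝ (EuclideanSpace ℝ (Fin n)) = n := finrank_euclideanSpace_fin
  have : Nontrivial (EuclideanSpace ℝ (Fin n)) :=
    Module.nontrivial_of_finrank_pos (R := ℝ) (by omega)
  set σ := (volume : Measure (EuclideanSpace ℝ (Fin n))).toSphere.real univ with hσ
  have : NeZero (volume : Measure (EuclideanSpace ℝ (Fin n))).toSphere :=
    ⟨Measure.toSphere_ne_zero _⟩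
  have hσ0 : 0 < σ := measureReal_univ_pos
  obtain ⟨f, f', q, C, l, hqA, hq0, hq, hlim, hC, hf, hf'c, hflux, hpos, hneg⟩ :=
    exists_radial_profile hn (div_pos hγ hσ0)
  have hfc : ContinuousOn f (Ioi 0) := fun r hr => (hf r hr).continuousAt.continuousWithinAt
  have hC1 : ContDiffOn ℝ 1 f (Ioi 0) := by
    rw [← zero_add (1 : WithTop ℕ∞), contDiffOn_succ_iff_deriv_of_isOpen isOpen_Ioi]
    refine ⟨fun r hr => (hf r hr).differentiableAt.differentiableWithinAt, by simp, ?_⟩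
    exact contDiffOn_zero.2 (hf'c.congr fun r hr => (hf r hr).deriv)
  have hmono : StrictMonoOn f (Ioc 0 1) := by
    refine strictMonoOn_of_deriv_pos (convex_Ioc 0 1) (hfc.mono fun r hr => hr.1) fun r hr => ?_
    rw [interior_Ioc] at hr
    rw [(hf r hr.1).deriv]
    exact hpos r hr
  have hanti : StrictAntiOn f (Ici 1) := by
    refine strictAntiOn_of_deriv_neg (convex_Ici 1)
      (hfc.mono fun r hr => mem_Ioi.2 (one_pos.trans_le hr)) fun r hr => ?_
    rw [interior_Ici] at hr
    rw [(hf r (one_pos.trans hr)).deriv]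
    exact hneg r hr
  have hmax : ∀ r, 0 < r → r ≠ 1 → f r < f 1 := fun r hr hr1 => by
    rcases hr1.lt_or_gt with h | h
    · exact hmono ⟨hr, h.le⟩ ⟨one_pos, le_rfl⟩ h
    · exact hanti self_mem_Ici h.le h
  have hint := integrable_exp_comp_norm (E := EuclideanSpace ℝ (Fin n)) volume (F := f) hq0
    (by rwa [hdim]) hlim
  have hscaled : ∀ lam : ℝ, 0 < lam → ∀ φ : EuclideanSpace ℝ (Fin n) → ℝ,
      ContDiff ℝ 1 φ → HasCompactSupport φ →
      ∫ x, ‖gradient (fun y : EuclideanSpace ℝ (Fin n) =>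
            f (lam * ‖y‖) + n * Real.log lam) x‖ ^ (n - 2) *
          ⟪gradient (fun y : EuclideanSpace ℝ (Fin n) =>
            f (lam * ‖y‖) + n * Real.log lam) x, gradient φ x⟫_ℝ
        = (∫ x : EuclideanSpace ℝ (Fin n),
            Real.exp (f (lam * ‖x‖) + n * Real.log lam) * φ x) - γ * φ 0 := by
    intro lam hlam φ hφ hφc
    obtain ⟨k, hk⟩ := Nat.exists_eq_add_of_le' hn
    have hk1 : n - 1 = k + 1 := by omega
    have hk2 : n - 2 = k := by omega
    have hmul : ∀ r, HasDerivAt (fun r => lam * r) lam r := fun r => by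
      simpa using (hasDerivAt_id r).const_mul lam
    have key := integral_norm_gradient_pow_mul_inner_eq
      (volume : Measure (EuclideanSpace ℝ (Fin n))) (hdim.symm ▸ hn)
      (F := fun r => f (lam * r) + n * Real.log lam) (F' := fun r => f' (lam * r) * lam)
      (q := fun r => q (lam * r)) (C := C) (l := l) ?_ ?_ ?_ (fun r hr => hC _ (by positivity))
      (fun r hr => ((hf _ (by positivity)).comp r (hmul r)).add_const _) ?_ hφ hφc
    · rw [hdim, ← hσ, mul_zero, hqA, mul_div_cancel₀ _ hσ0.ne'] at key
      exact key
    · refine ContinuousWithinAt.comp (t := Ici 0) (by rwa [mul_zero])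
        (hmul 0).continuousAt.continuousWithinAt fun r hr => ?_
      exact mul_nonneg hlam.le hr
    · intro r hr
      refine ((hq _ (by positivity)).comp r (hmul r)).congr_deriv ?_
      rw [hdim, hk1, Real.exp_add, Real.exp_nat_mul, Real.exp_log hlam, hk]
      ring
    · exact hlim.comp (tendsto_id.const_mul_atTop hlam)
    · intro r hr
      rw [hdim, ← hflux _ (by positivity), hk1, hk2, abs_mul, abs_of_pos hlam]
      ring
  refine ⟨f, hC1, ?_, hint, fun φ hφ hφc => ?_, hmono.mono Ioo_subset_Ioc_self,
    hanti.mono Ioi_subset_Ici_self, fun r hr => ?_, fun lam hlam =>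
      ⟨hscaled lam hlam, fun r hr hne => ?_⟩⟩
  · exact hC1.comp (fun x hx => (contDiffAt_norm ℝ hx).contDiffWithinAt)
      fun x hx => norm_pos_iff.2 hx
  · simpa using hscaled 1 one_pos φ hφ hφc
  · rcases eq_or_ne r 1 with rfl | h
    · exact le_rfl
    · exact (hmax r hr h).le
  · rw [mul_one_div_cancel hlam.ne']
    refine add_lt_add_left (hmax _ (mul_pos hlam hr) fun h => hne ?_) _
    rw [eq_div_iff hlam.ne', mul_comm, h]
end

section
/- Let n ≥ 2 be an integer, r₀ > 0, α₀ ∈ ℝ, and α₁ ∈ ℝ with α₁ ≠ 0. Then there exist δ ∈ (0, r₀) and a C¹ function U : [r₀ − δ, r₀ + δ] → ℝ such that U(r₀) = α₀, U'(r₀) = α₁, and for all r ∈ [r₀ − δ, r₀ + δ], r^{n−1} |U'(r)|^{n−2} U'(r) = r₀^{n−1} |α₁|^{n−2} α₁ − ∫_{r₀}^{r} t^{n−1} e^{U(t)} dt. -/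
open MeasureTheory Metric Filter Topology Real Set
open scoped InnerProductSpace

/-- Local solvability of a scalar second-order initial value problem `u'' = F (t, u, u')` with
`F` of class `C¹` near the initial data. -/
theorem exists_local_solution_second_order {F : ℝ × ℝ × ℝ → ℝ} {t₀ a b : ℝ}
    (hF : ContDiffAt ℝ 1 F (t₀, a, b)) :
    ∃ ε > 0, ∃ u v : ℝ → ℝ, u t₀ = a ∧ v t₀ = b ∧
      ∀ t ∈ Ioo (t₀ - ε) (t₀ + ε), HasDerivAt u (v t) t ∧ HasDerivAt v (F (t, u t, v t)) t := by
  have hfield : ContDiffAt ℝ 1 (fun p : ℝ × ℝ × ℝ ↦ ((1 : ℝ), p.2.2, F p)) (t₀, a, b) :=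
    contDiffAt_const.prodMk ((by fun_prop : ContDiffAt ℝ 1 (fun p : ℝ × ℝ × ℝ ↦ p.2.2) _).prodMk hF)
  obtain ⟨γ, hγ₀, ε, hε, hγ⟩ :=
    hfield.exists_forall_mem_closedBall_exists_eq_forall_mem_Ioo_hasDerivAt₀ t₀
  have htime : ∀ t ∈ Ioo (t₀ - ε) (t₀ + ε), HasDerivAt (fun s ↦ (γ s).1) 1 t :=
    fun t ht ↦ (hasFDerivAt_fst (p := γ t)).comp_hasDerivAt t (hγ t ht)
  have htime_eq : EqOn (fun s ↦ (γ s).1) id (Ioo (t₀ - ε) (t₀ + ε)) := by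
    refine isOpen_Ioo.eqOn_of_deriv_eq isPreconnected_Ioo
      (fun t ht ↦ (htime t ht).differentiableAt.differentiableWithinAt)
      differentiableOn_id (fun t ht ↦ ?_) (x := t₀) ⟨by linarith, by linarith⟩ (by simp [hγ₀])
    rw [(htime t ht).deriv, deriv_id]
  refine ⟨ε, hε, fun t ↦ (γ t).2.1, fun t ↦ (γ t).2.2, by simp [hγ₀], by simp [hγ₀],
    fun t ht ↦ ?_⟩
  have hsnd : HasDerivAt (fun s ↦ (γ s).2) ((γ t).2.2, F (γ t)) t :=
    (hasFDerivAt_snd (p := γ t)).comp_hasDerivAt t (hγ t ht)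
  have hpt : (t, (γ t).2.1, (γ t).2.2) = γ t := Prod.ext (htime_eq ht).symm rfl
  rw [hpt]
  have hu : HasDerivAt (fun s ↦ (γ s).2.1) (γ t).2.2 t :=
    (hasFDerivAt_fst (𝕜 := ℝ) (p := (γ t).2)).comp_hasDerivAt (f := fun s ↦ (γ s).2) t hsnd
  have hv : HasDerivAt (fun s ↦ (γ s).2.2) (F (γ t)) t :=
    (hasFDerivAt_snd (𝕜 := ℝ) (p := (γ t).2)).comp_hasDerivAt (f := fun s ↦ (γ s).2) t hsnd
  exact ⟨hu, hv⟩

/-- Along solutions of the radial `(k + 2)`-Liouville equation in normal form, the flux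
`r ^ (k + 1) * |u'| ^ k * u'` has derivative `-r ^ (k + 1) * exp u`. -/
theorem hasDerivAt_radial_flux {k : ℕ} {s t y : ℝ} {v : ℝ → ℝ} (ht : t ≠ 0) (hs : s * s = 1)
    (hv : s * v t ≠ 0)
    (h : HasDerivAt v (-Real.exp y / ((k + 1) * (s * v t) ^ k) - v t / t) t) :
    HasDerivAt (fun r ↦ r ^ (k + 1) * (s * v r) ^ k * v r) (-(t ^ (k + 1) * Real.exp y)) t := by
  have hflux : (fun r ↦ r ^ (k + 1) * (s * v r) ^ k * v r)
      = fun r ↦ s * (r ^ (k + 1) * (s * v r) ^ (k + 1)) := by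
    funext r
    linear_combination (-r ^ (k + 1) * (s * v r) ^ k * v r) * hs
  rw [hflux]
  refine ((((hasDerivAt_id t).pow (k + 1)).mul ((h.const_mul s).pow (k + 1))).const_mul s).congr_deriv
    ?_
  simp only [Nat.add_sub_cancel, id, Pi.pow_apply]
  push_cast
  have hk : (k + 1 : ℝ) ≠ 0 := by positivity
  have hw : (s * v t) ^ k ≠ 0 := pow_ne_zero _ hv
  simp only [pow_succ]
  generalize (s * v t) ^ k = w at *
  field_simp
  linear_combination (-t * Real.exp y) * hs

theorem radial_cauchy_problem_local_existence
    (n : ℕ) (hn : 2 ≤ n) (r₀ α₀ α₁ : ℝ) (hr₀ : 0 < r₀) (hα₁ : α₁ ≠ 0) :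
    ∃ δ : ℝ, 0 < δ ∧ δ < r₀ ∧ ∃ U U' : ℝ → ℝ,
      ContinuousOn U' (Icc (r₀ - δ) (r₀ + δ)) ∧
      (∀ r ∈ Icc (r₀ - δ) (r₀ + δ), HasDerivWithinAt U (U' r) (Icc (r₀ - δ) (r₀ + δ)) r) ∧
      U r₀ = α₀ ∧ U' r₀ = α₁ ∧
      ∀ r ∈ Icc (r₀ - δ) (r₀ + δ),
        r ^ (n - 1) * |U' r| ^ (n - 2) * U' r
          = r₀ ^ (n - 1) * |α₁| ^ (n - 2) * α₁
            - ∫ t in r₀..r, t ^ (n - 1) * Real.exp (U t) := by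
  obtain ⟨k, rfl⟩ := Nat.exists_eq_add_of_le' hn
  obtain ⟨s, hs, hsα⟩ : ∃ s : ℝ, s * s = 1 ∧ 0 < s * α₁ := by
    rcases hα₁.lt_or_gt with h | h
    · exact ⟨-1, by norm_num, by linarith⟩
    · exact ⟨1, by norm_num, by linarith⟩
  have hF : ContDiffAt ℝ 1 (fun p : ℝ × ℝ × ℝ ↦
      -Real.exp p.2.1 / ((k + 1) * (s * p.2.2) ^ k) - p.2.2 / p.1) (r₀, α₀, α₁) := by
    refine ContDiffAt.sub (ContDiffAt.div (by fun_prop) (by fun_prop) ?_)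
      (ContDiffAt.div (by fun_prop) (by fun_prop) hr₀.ne')
    dsimp only
    positivity
  obtain ⟨ε, hε, U, V, hU₀, hV₀, hUV⟩ := exists_local_solution_second_order hF
  have hVcont : ContinuousAt V r₀ := (hUV r₀ ⟨by linarith, by linarith⟩).2.continuousAt
  obtain ⟨η, hη, hsV⟩ : ∃ η > 0, ∀ r, dist r r₀ < η → 0 < s * V r :=
    Metric.eventually_nhds_iff.mp
      ((continuousAt_const.mul hVcont).eventually (lt_mem_nhds (by simpa [hV₀] using hsα)))
  obtain ⟨δ, hδ, hδm⟩ := exists_between (lt_min (lt_min hε hη) hr₀)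
  simp only [lt_min_iff] at hδm
  obtain ⟨⟨hδε, hδη⟩, hδr⟩ := hδm
  have hIoo : ∀ r ∈ Icc (r₀ - δ) (r₀ + δ), r ∈ Ioo (r₀ - ε) (r₀ + ε) :=
    fun r hr ↦ ⟨by linarith [hr.1], by linarith [hr.2]⟩
  have hpos : ∀ r ∈ Icc (r₀ - δ) (r₀ + δ), 0 < s * V r := fun r hr ↦
    hsV r (abs_lt.mpr ⟨by linarith [hr.1], by linarith [hr.2]⟩)
  have habs : ∀ r ∈ Icc (r₀ - δ) (r₀ + δ), |V r| = s * V r := fun r hr ↦ by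
    have hs1 : |s| = 1 := by rcases mul_self_eq_one_iff.mp hs with h | h <;> simp [h]
    rw [← abs_of_pos (hpos r hr), abs_mul, hs1, one_mul]
  have hmem₀ : r₀ ∈ Icc (r₀ - δ) (r₀ + δ) := ⟨by linarith, by linarith⟩
  refine ⟨δ, hδ, hδr, U, V,
    fun r hr ↦ (hUV r (hIoo r hr)).2.continuousAt.continuousWithinAt,
    fun r hr ↦ (hUV r (hIoo r hr)).1.hasDerivWithinAt, hU₀, hV₀, fun r hr ↦ ?_⟩
  have hsub : uIcc r₀ r ⊆ Icc (r₀ - δ) (r₀ + δ) := uIcc_subset_Icc hmem₀ hr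
  have hcont : ContinuousOn (fun t ↦ -(t ^ (k + 1) * Real.exp (U t))) (uIcc r₀ r) := fun t ht ↦ by
    have hUt := (hUV t (hIoo t (hsub ht))).1.continuousAt
    exact ContinuousAt.continuousWithinAt (by fun_prop)
  have hFTC := intervalIntegral.integral_eq_sub_of_hasDerivAt
    (fun t ht ↦ hasDerivAt_radial_flux (by linarith [(hsub ht).1] : 0 < t).ne' hs
      (hpos t (hsub ht)).ne' (hUV t (hIoo t (hsub ht))).2) hcont.intervalIntegrable
  rw [intervalIntegral.integral_neg] at hFTC
  have hα₁abs := habs r₀ hmem₀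
  rw [hV₀] at hα₁abs hFTC
  rw [show k + 2 - 1 = k + 1 from rfl, Nat.add_sub_cancel, habs r hr, hα₁abs]
  linarith
end

section
/- Let n ≥ 2 be an integer, r₀ > 0, and α₀ ∈ ℝ. (i) If α₁ > 0, then there exists a C¹ function U : (0, r₀] → ℝ with U(r₀) = α₀, U'(r₀) = α₁, such that for all r ∈ (0, r₀], r^{n−1} |U'(r)|^{n−2} U'(r) = r₀^{n−1} α₁^{n−1} − ∫_{r₀}^{r} t^{n−1} e^{U(t)} dt. (ii) If α₁ < 0, then there exists a C¹ function U : [r₀, ∞) → ℝ with U(r₀) = α₀, U'(r₀) = α₁, such that for all r ∈ [r₀, ∞), r^{n−1} |U'(r)|^{n−2} U'(r) = −r₀^{n−1} |α₁|^{n−1} − ∫_{r₀}^{r} t^{n−1} e^{U(t)} dt. -/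
open MeasureTheory Metric Filter Topology Real Set
open scoped InnerProductSpace

/-- A scalar autonomous ODE with a continuous, positive and bounded right-hand side has a global
solution through every point. -/
lemma exists_hasDerivAt_autonomous_of_pos_of_le {g : ℝ → ℝ} (hg : Continuous g)
    (hpos : ∀ x, 0 < g x) {M : ℝ} (hM : ∀ x, g x ≤ M) (x₀ : ℝ) :
    ∃ x : ℝ → ℝ, x 0 = x₀ ∧ ∀ s, HasDerivAt x (g (x s)) s := by
  have hMpos : 0 < M := (hpos 0).trans_le (hM 0)
  have hinv : Continuous fun x => (g x)⁻¹ := hg.inv₀ fun x => (hpos x).ne'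
  set T : ℝ → ℝ := fun x => ∫ t in x₀..x, (g t)⁻¹ with hT
  have hderiv (x : ℝ) : HasDerivAt T (g x)⁻¹ x :=
    intervalIntegral.integral_hasDerivAt_right (hinv.intervalIntegrable _ _)
      (hinv.stronglyMeasurableAtFilter _ _) hinv.continuousAt
  have hcont : Continuous T := continuous_iff_continuousAt.2 fun x => (hderiv x).continuousAt
  have hmono : StrictMono T := strictMono_of_deriv_pos fun x => by
    rw [(hderiv x).deriv]; exact inv_pos.2 (hpos x)
  have hgrowth {a b : ℝ} (hab : a ≤ b) : M⁻¹ * (b - a) ≤ T b - T a :=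
    mul_sub_le_image_sub_of_le_deriv (fun x => (hderiv x).differentiableAt)
      (fun x => by rw [(hderiv x).deriv]; exact inv_anti₀ (hpos x) (hM x)) hab
  have hT0 : T x₀ = 0 := intervalIntegral.integral_same
  have htop : Tendsto T atTop atTop := by
    refine tendsto_atTop_mono' atTop ?_ ((tendsto_atTop_add_const_right atTop (-x₀)
      tendsto_id).const_mul_atTop (inv_pos.2 hMpos))
    filter_upwards [eventually_ge_atTop x₀] with x hx
    simpa [hT0, sub_eq_add_neg] using hgrowth hx
  have hbot : Tendsto T atBot atBot := by
    refine tendsto_atBot_mono' atBot ?_ ((tendsto_atBot_add_const_right atBot (-x₀)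
      tendsto_id).const_mul_atBot (inv_pos.2 hMpos))
    filter_upwards [eventually_le_atBot x₀] with x hx
    have := hgrowth hx
    rw [hT0] at this
    simp only [id]
    linarith
  let e : ℝ ≃o ℝ := hmono.orderIsoOfSurjective T (hcont.surjective htop hbot)
  have hright (s : ℝ) : T (e.symm s) = s := e.apply_symm_apply s
  refine ⟨e.symm, hmono.injective ((hright 0).trans hT0.symm), fun s => ?_⟩
  simpa using (hderiv (e.symm s)).of_local_left_inverse e.symm.continuous.continuousAt
    (inv_pos.2 (hpos _)).ne' (Eventually.of_forall hright)

/-- A scalar autonomous ODE whose right-hand side is positive on `[c, b)` and decays at least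
linearly at `b` has a forward-global solution starting at `c`. -/
lemma exists_hasDerivAt_autonomous_Ico {H : ℝ → ℝ} {c b L : ℝ} (hcb : c < b)
    (hH : ContinuousOn H (Ico c b)) (hpos : ∀ y ∈ Ico c b, 0 < H y)
    (hL : ∀ y ∈ Ico c b, H y ≤ L * (b - y)) :
    ∃ y : ℝ → ℝ, y 0 = c ∧ ∀ s, 0 ≤ s → y s ∈ Ico c b ∧ HasDerivAt y (H (y s)) s := by
  set Y : ℝ → ℝ := fun x => b - Real.exp (-x) with hY
  have hYcont : Continuous Y := by fun_prop
  have hYlt (x : ℝ) : Y x < b := sub_lt_self _ (Real.exp_pos _)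
  have hmem (x : ℝ) : max (Y x) c ∈ Ico c b := ⟨le_max_right _ _, max_lt (hYlt x) hcb⟩
  have hL0 : 0 ≤ L := by
    have hc : c ∈ Ico c b := ⟨le_rfl, hcb⟩
    exact (pos_of_mul_pos_left ((hpos c hc).trans_le (hL c hc)) (sub_nonneg.2 hcb.le)).le
  obtain ⟨x, hx0, hx⟩ := exists_hasDerivAt_autonomous_of_pos_of_le
    (g := fun x => Real.exp x * H (max (Y x) c)) (M := L)
    (Real.continuous_exp.mul (hH.comp_continuous (hYcont.max continuous_const) hmem))
    (fun x => mul_pos (Real.exp_pos x) (hpos _ (hmem x)))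
    (fun x => by
      have h1 : b - max (Y x) c ≤ Real.exp (-x) := by
        have := le_max_left (Y x) c
        simp only [hY] at this ⊢
        linarith
      calc Real.exp x * H (max (Y x) c)
          ≤ Real.exp x * (L * Real.exp (-x)) := by
            gcongr
            exact (hL _ (hmem x)).trans (by gcongr)
        _ = L := by rw [mul_left_comm, ← Real.exp_add]; simp)
    (-Real.log (b - c))
  have hder (s : ℝ) : HasDerivAt (fun s => Y (x s)) (H (max (Y (x s)) c)) s := by
    have := ((hx s).neg.exp).const_sub b
    refine this.congr_deriv ?_
    have h : Real.exp (-x s) * Real.exp (x s) = 1 := by rw [← Real.exp_add]; simp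
    linear_combination H (max (Y (x s)) c) * h
  have h0 : Y (x 0) = c := by
    simp [hY, hx0, Real.exp_log (sub_pos.2 hcb)]
  have hmono : Monotone fun s => Y (x s) :=
    monotone_of_deriv_nonneg (fun s => (hder s).differentiableAt) fun s => by
      rw [(hder s).deriv]; exact (hpos _ (hmem _)).le
  refine ⟨fun s => Y (x s), h0, fun s hs => ?_⟩
  have hc : c ≤ Y (x s) := h0 ▸ hmono hs
  exact ⟨⟨hc, hYlt _⟩, by simpa [max_eq_left hc] using hder s⟩

/-- The function `B + κ (y ^ m - c ^ m) - m / (m + 1) * (y ^ (m + 1) - c ^ (m + 1))`. -/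
noncomputable def liouvilleEnergy (m : ℕ) (κ c B y : ℝ) : ℝ :=
  B + κ * (y ^ m - c ^ m) - m / (m + 1) * (y ^ (m + 1) - c ^ (m + 1))

lemma hasDerivAt_liouvilleEnergy (m : ℕ) (κ c B y : ℝ) :
    HasDerivAt (liouvilleEnergy m κ c B) (m * y ^ (m - 1) * (κ - y)) y := by
  have h := ((((hasDerivAt_pow m y).sub_const (c ^ m)).const_mul κ).const_add B).sub
    (((hasDerivAt_pow (m + 1) y).sub_const (c ^ (m + 1))).const_mul ((m : ℝ) / (m + 1)))
  refine h.congr_deriv ?_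
  rcases m with _ | m
  · simp
  · push_cast
    field_simp
    ring

lemma exists_liouvilleEnergy_nonpos {m : ℕ} (hm : 1 ≤ m) (κ c B : ℝ) :
    ∃ y, c ≤ y ∧ liouvilleEnergy m κ c B y ≤ 0 := by
  set D : ℝ := B - κ * c ^ m + m / (m + 1) * c ^ (m + 1) with hD
  have hm' : (1 : ℝ) ≤ m := by exact_mod_cast hm
  set y : ℝ := 1 + |c| + 2 * (|κ| + |D|) with hy
  have hy1 : 1 ≤ y := by
    have := abs_nonneg c; have := abs_nonneg κ; have := abs_nonneg D; linarith
  refine ⟨y, ?_, ?_⟩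
  · have := le_abs_self c; have := abs_nonneg κ; have := abs_nonneg D; linarith
  have hhalf : (1 : ℝ) / 2 ≤ m / (m + 1) := by
    rw [div_le_div_iff₀ (by norm_num) (by positivity)]; linarith
  have hlin : κ - m / (m + 1) * y ≤ -|D| := by
    have h1 : 1 / 2 * y ≤ m / (m + 1) * y := by gcongr
    have := le_abs_self κ; have := abs_nonneg c
    linarith
  have hpow : 1 ≤ y ^ m := one_le_pow₀ hy1
  have h2 : y ^ m * (κ - m / (m + 1) * y) ≤ y ^ m * (-|D|) := by gcongr
  have h3 : |D| ≤ y ^ m * |D| := le_mul_of_one_le_left (abs_nonneg _) hpow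
  have h4 : liouvilleEnergy m κ c B y = D + y ^ m * (κ - m / (m + 1) * y) := by
    simp only [liouvilleEnergy, hD]; ring
  have := le_abs_self D
  linarith

lemma exists_hasDerivAt_liouvilleEnergy_flow {m : ℕ} (hm : 1 ≤ m) (κ : ℝ) {c B : ℝ} (hc : 0 < c)
    (hB : 0 < B) :
    ∃ y : ℝ → ℝ, y 0 = c ∧ ∀ s, 0 ≤ s → 0 < y s ∧ 0 < liouvilleEnergy m κ c B (y s) ∧
      HasDerivAt y (liouvilleEnergy m κ c B (y s) / (m * y s ^ (m - 1))) s := by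
  have hm' : (0 : ℝ) < m := by exact_mod_cast hm
  set E := liouvilleEnergy m κ c B with hE
  have hEd (y : ℝ) : HasDerivAt E (m * y ^ (m - 1) * (κ - y)) y :=
    hasDerivAt_liouvilleEnergy m κ c B y
  have hEcont : Continuous E := continuous_iff_continuousAt.2 fun y => (hEd y).continuousAt
  have hEc : E c = B := by simp [hE, liouvilleEnergy]
  set S : Set ℝ := Ici c ∩ E ⁻¹' Iic 0 with hS
  have hSclosed : IsClosed S := isClosed_Ici.inter (isClosed_Iic.preimage hEcont)
  have hSne : S.Nonempty := exists_liouvilleEnergy_nonpos hm κ c B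
  have hSbdd : BddBelow S := ⟨c, fun y hy => hy.1⟩
  obtain ⟨hb₁, hb₂⟩ : sInf S ∈ S := hSclosed.csInf_mem hSne hSbdd
  set b := sInf S with hb
  simp only [mem_Ici, mem_preimage, mem_Iic] at hb₁ hb₂
  have hcb : c < b := hb₁.lt_of_ne fun h => by rw [← h, hEc] at hb₂; linarith
  have hEpos {y : ℝ} (hy : y ∈ Ico c b) : 0 < E y := by
    by_contra! h
    exact (csInf_le hSbdd ⟨hy.1, h⟩).not_gt hy.2
  set L : ℝ := m * b ^ (m - 1) * (|κ| + b) with hL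
  have hEle {y : ℝ} (hy : y ∈ Ico c b) : E y ≤ L * (b - y) := by
    have := (convex_Icc c b).mul_sub_le_image_sub_of_le_deriv (f := E) (C := -L)
      hEcont.continuousOn (fun z _ => (hEd z).differentiableAt.differentiableWithinAt)
      (fun z hz => by
        rw [interior_Icc] at hz
        have hz0 : 0 < z := hc.trans hz.1
        rw [(hEd z).deriv, hL, ← mul_neg]
        have h1 : (m : ℝ) * z ^ (m - 1) * (|κ| + z) ≤ m * b ^ (m - 1) * (|κ| + b) := by
          have := hz.2.le
          have hb0 : 0 < b := hc.trans hcb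
          gcongr
        have h2 : (m : ℝ) * z ^ (m - 1) * (-(|κ| + z)) ≤ m * z ^ (m - 1) * (κ - z) := by
          gcongr
          linarith [neg_abs_le κ]
        linarith) y ⟨hy.1, hy.2.le⟩ b ⟨hcb.le, le_rfl⟩ hy.2.le
    linarith
  have hden {y : ℝ} (hy : y ∈ Ico c b) : 0 < (m : ℝ) * y ^ (m - 1) :=
    mul_pos hm' (pow_pos (hc.trans_le hy.1) _)
  obtain ⟨y, hy0, hy⟩ := exists_hasDerivAt_autonomous_Ico
    (H := fun y => E y / (m * y ^ (m - 1))) (L := L / (m * c ^ (m - 1))) hcb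
    (hEcont.continuousOn.div (by fun_prop) fun y hy => (hden hy).ne')
    (fun y hy => div_pos (hEpos hy) (hden hy))
    (fun y hy => by
      have hcy := hy.1
      rw [div_mul_eq_mul_div]
      exact div_le_div₀ ((hEpos hy).le.trans (hEle hy)) (hEle hy) (by positivity) (by gcongr))
  exact ⟨y, hy0, fun s hs => ⟨hc.trans_le (hy s hs).1.1, hEpos (hy s hs).1, (hy s hs).2⟩⟩

/-- Forward-global solvability of the radial `n`-Liouville equation in the logarithmic variable,
as the system `V' = -y`, `(y ^ m)' = R e ^ (κ s + V)`. -/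
lemma exists_radial_liouville_log_system {m : ℕ} (hm : 1 ≤ m) (κ α : ℝ) {c R : ℝ} (hc : 0 < c)
    (hR : 0 < R) :
    ∃ V y : ℝ → ℝ, V 0 = α ∧ y 0 = c ∧ ∀ s, 0 ≤ s → 0 < y s ∧ ContinuousAt y s ∧
      HasDerivAt V (-y s) s ∧
      HasDerivAt (fun s => y s ^ m) (R * Real.exp (κ * s + V s)) s := by
  obtain ⟨y, hy0, hy⟩ := exists_hasDerivAt_liouvilleEnergy_flow hm κ hc
    (mul_pos hR (Real.exp_pos α))
  set E := liouvilleEnergy m κ c (R * Real.exp α) with hE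
  have hm' : (0 : ℝ) < m := by exact_mod_cast hm
  refine ⟨fun s => Real.log (E (y s)) - κ * s - Real.log R, y, ?_, hy0, fun s hs => ?_⟩
  · have hEc : E c = R * Real.exp α := by simp [hE, liouvilleEnergy]
    simp [hy0, hEc, Real.log_mul hR.ne' (Real.exp_pos α).ne']
  obtain ⟨hypos, hEpos, hyd⟩ := hy s hs
  have hden : (m : ℝ) * y s ^ (m - 1) ≠ 0 := by positivity
  refine ⟨hypos, hyd.continuousAt, ?_, ?_⟩
  · have h := (((hasDerivAt_liouvilleEnergy m κ c (R * Real.exp α) (y s)).comp s hyd).log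
      hEpos.ne').sub ((hasDerivAt_id s).const_mul κ) |>.sub_const (Real.log R)
    refine h.congr_deriv ?_
    simp only [Function.comp_apply, ← hE]
    have := hEpos.ne'
    field_simp
    ring
  · refine (hyd.pow m).congr_deriv ?_
    rw [mul_div_cancel₀ _ hden, show κ * s + (Real.log (E (y s)) - κ * s - Real.log R)
      = Real.log (E (y s)) - Real.log R by ring, Real.exp_sub, Real.exp_log hEpos,
      Real.exp_log hR, mul_div_cancel₀ _ hR.ne']

/-- Both Cauchy problems at once: `σ = 1` is the outward problem and `σ = -1` the inward one. -/
lemma exists_radial_liouville {n : ℕ} (hn : 2 ≤ n) {r₀ α β σ : ℝ} (hr₀ : 0 < r₀) (hβ : 0 < β)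
    (hσ : σ = 1 ∨ σ = -1) {D : Set ℝ} (hD : D.OrdConnected) (hr₀D : r₀ ∈ D)
    (hDpos : ∀ r ∈ D, 0 < r) (hDlog : ∀ r ∈ D, 0 ≤ σ * Real.log (r / r₀)) :
    ∃ U U' : ℝ → ℝ, ContinuousOn U' D ∧ (∀ r ∈ D, HasDerivWithinAt U (U' r) D r) ∧
      U r₀ = α ∧ U' r₀ = -σ * β ∧
      ∀ r ∈ D, r ^ (n - 1) * |U' r| ^ (n - 2) * U' r
        = -σ * (r₀ ^ (n - 1) * β ^ (n - 1)) - ∫ t in r₀..r, t ^ (n - 1) * Real.exp (U t) := by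
  obtain ⟨m, rfl⟩ : ∃ m, n = m + 2 := ⟨n - 2, by omega⟩
  have hσσ : σ * σ = 1 := by rcases hσ with rfl | rfl <;> norm_num
  have hσabs : |σ| = 1 := by rcases hσ with rfl | rfl <;> norm_num
  obtain ⟨V, y, hV0, hy0, hVy⟩ := exists_radial_liouville_log_system (m := m + 1) (by omega)
    (σ * (m + 2)) α (mul_pos hr₀ hβ) (pow_pos hr₀ (m + 2))
  set S : ℝ → ℝ := fun r => σ * Real.log (r / r₀) with hS
  have hS0 : S r₀ = 0 := by simp [hS, hr₀.ne']
  have hSd {r : ℝ} (hr : r ∈ D) : HasDerivAt S (σ / r) r := by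
    have hr' := hDpos r hr
    have h := (((hasDerivAt_id r).div_const r₀).log (div_pos hr' hr₀).ne').const_mul σ
    refine h.congr_deriv ?_
    simp only [id]
    field_simp
  have hUd {r : ℝ} (hr : r ∈ D) : HasDerivAt (fun r => V (S r)) (-σ * y (S r) / r) r := by
    refine ((hVy _ (hDlog r hr)).2.2.1.comp r (hSd hr)).congr_deriv ?_
    ring
  have hPd {r : ℝ} (hr : r ∈ D) : HasDerivAt (fun r => σ * y (S r) ^ (m + 1))
      (r ^ (m + 1) * Real.exp (V (S r))) r := by
    have hr' := hDpos r hr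
    have h := ((hVy _ (hDlog r hr)).2.2.2.comp r (hSd hr)).const_mul σ
    refine h.congr_deriv ?_
    have hexp : Real.exp (σ * (m + 2) * S r) = (r / r₀) ^ (m + 2) := by
      rw [show σ * (m + 2) * S r = ((m + 2 : ℕ) : ℝ) * Real.log (r / r₀) by
        simp only [hS]; push_cast; linear_combination ((m : ℝ) + 2) * Real.log (r / r₀) * hσσ,
        Real.exp_nat_mul, Real.exp_log (div_pos hr' hr₀)]
    rw [Real.exp_add, hexp, div_pow]
    field_simp
    linear_combination r ^ (m + 2) * Real.exp (V (S r)) * hσσ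
  refine ⟨fun r => V (S r), fun r => -σ * y (S r) / r, fun r hr => ?_,
    fun r hr => (hUd hr).hasDerivWithinAt, by simp [hS0, hV0], ?_, fun r hr => ?_⟩
  · have h := ContinuousAt.comp (g := y) (f := S) (hVy _ (hDlog r hr)).2.1 (hSd hr).continuousAt
    exact ((h.const_mul (-σ)).div continuousAt_id (hDpos r hr).ne').continuousWithinAt
  · simp only [hS0, hy0]
    field_simp
  · have hr' := hDpos r hr
    have hsub : uIcc r₀ r ⊆ D := hD.uIcc_subset hr₀D hr
    have hint := intervalIntegral.integral_eq_sub_of_hasDerivAt (fun t ht => hPd (hsub ht))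
      (ContinuousOn.intervalIntegrable fun t ht =>
        ((continuous_pow (m + 1)).continuousAt.mul
          (Real.continuous_exp.continuousAt.comp (hUd (hsub ht)).continuousAt)).continuousWithinAt)
    have hyr := (hVy _ (hDlog r hr)).1
    have habs : |-σ * y (S r) / r| = y (S r) / r := by
      rw [abs_div, abs_mul, abs_neg, hσabs, one_mul, abs_of_pos hyr, abs_of_pos hr']
    rw [show m + 2 - 1 = m + 1 by omega, show m + 2 - 2 = m by omega]
    rw [hint, hS0, hy0, habs, div_pow, mul_pow]
    field_simp
    ring

theorem radial_cauchy_problem_global_existence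
    (n : ℕ) (hn : 2 ≤ n) (r₀ α₀ α₁ : ℝ) (hr₀ : 0 < r₀) :
    (0 < α₁ → ∃ U U' : ℝ → ℝ,
      ContinuousOn U' (Ioc 0 r₀) ∧
      (∀ r ∈ Ioc (0 : ℝ) r₀, HasDerivWithinAt U (U' r) (Ioc (0 : ℝ) r₀) r) ∧
      U r₀ = α₀ ∧ U' r₀ = α₁ ∧
      ∀ r ∈ Ioc (0 : ℝ) r₀,
        r ^ (n - 1) * |U' r| ^ (n - 2) * U' r
          = r₀ ^ (n - 1) * α₁ ^ (n - 1)
            - ∫ t in r₀..r, t ^ (n - 1) * Real.exp (U t)) ∧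
    (α₁ < 0 → ∃ U U' : ℝ → ℝ,
      ContinuousOn U' (Ici r₀) ∧
      (∀ r ∈ Ici r₀, HasDerivWithinAt U (U' r) (Ici r₀) r) ∧
      U r₀ = α₀ ∧ U' r₀ = α₁ ∧
      ∀ r ∈ Ici r₀,
        r ^ (n - 1) * |U' r| ^ (n - 2) * U' r
          = -(r₀ ^ (n - 1) * |α₁| ^ (n - 1))
            - ∫ t in r₀..r, t ^ (n - 1) * Real.exp (U t)) := by
  refine ⟨fun h => ?_, fun h => ?_⟩
  · have hlog (r : ℝ) (hr : r ∈ Ioc 0 r₀) : 0 ≤ (-1) * Real.log (r / r₀) := by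
      have := Real.log_nonpos (div_nonneg hr.1.le hr₀.le) ((div_le_one hr₀).2 hr.2)
      linarith
    simpa using exists_radial_liouville (α := α₀) hn hr₀ h (Or.inr rfl) ordConnected_Ioc
      ⟨hr₀, le_rfl⟩ (fun r hr => hr.1) hlog
  · have hlog (r : ℝ) (hr : r ∈ Ici r₀) : 0 ≤ 1 * Real.log (r / r₀) := by
      rw [one_mul]
      exact Real.log_nonneg ((one_le_div hr₀).2 hr)
    simpa [abs_of_neg h] using exists_radial_liouville (α := α₀) hn hr₀ (neg_pos.2 h) (Or.inl rfl)
      ordConnected_Ici self_mem_Ici (fun r hr => hr₀.trans_le hr) hlog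
end
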